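/- arXiv:2312.10909 — 2 statements merged into one kernel-verified Lean document; each statement's English description precedes it below -/
import Mathlib

section
/- For every positive integer l there exists a positive integer N such that for all integers n ≥ N, (√12·π²·e^{μ(n)}/(36·μ(n)²))·(1 − 1/μ(n) − 1/μ(n)^l) < p(n) < (√12·π²·e^{μ(n)}/(36·μ(n)²))·(1 − 1/μ(n) + 1/μ(n)^l). -/
/-- The partition function: the number of partitions of `n`. -/
def partitionFn (n : ℕ) : ℕ := Fintype.card (Nat.Partition n)

/-- `μ(n) = π √(24 n - 1) / 6`. -/
noncomputable def muP (n : ℕ) : ℝ := Real.pi * Real.sqrt (24 * (n : ℝ) - 1) / 6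

open Filter Topology

/-- The power series `∑ X ^ (d * j)`. -/
noncomputable def geomPowerSeries (d : ℕ) : PowerSeries ℝ :=
  PowerSeries.mk fun n => if d ∣ n then 1 else 0

/-- The generating function of partitions into parts of size at most `K`. -/
noncomputable def truncPartitionSeries (K : ℕ) : PowerSeries ℝ :=
  ∏ i ∈ Finset.range K, geomPowerSeries (i + 1)

theorem truncPartitionSeries_succ (K : ℕ) :
    truncPartitionSeries (K + 1) = truncPartitionSeries K * geomPowerSeries (K + 1) :=
  Finset.prod_range_succ _ _

open scoped PowerSeries.WithPiTopology in
theorem tsum_X_pow_mul (d : ℕ) (hd : 0 < d) :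
    (∑' j : ℕ, (PowerSeries.X : PowerSeries ℝ) ^ (d * j)) = geomPowerSeries d := by
  refine HasSum.tsum_eq ?_
  rw [PowerSeries.WithPiTopology.hasSum_iff_hasSum_coeff]
  intro n
  simp only [PowerSeries.coeff_X_pow, geomPowerSeries, PowerSeries.coeff_mk]
  by_cases h : d ∣ n
  · obtain ⟨k, rfl⟩ := h
    simp only [dvd_mul_right, if_true]
    have h : (fun j => if d * k = d * j then (1 : ℝ) else 0) = fun j => if j = k then 1 else 0 := by
      ext j
      simp [hd.ne', eq_comm]
    rw [h]
    exact hasSum_ite_eq k 1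
  · have h' : (fun j => if n = d * j then (1 : ℝ) else 0) = fun _ => 0 := by
      ext j
      exact if_neg fun hj => h ⟨j, hj⟩
    rw [if_neg h, h']
    exact hasSum_zero

theorem hasSum_geomPowerSeries (d : ℕ) (hd : 0 < d) {q : ℂ} (hq : ‖q‖ < 1) :
    HasSum (fun n => ((PowerSeries.coeff n (geomPowerSeries d) : ℝ) : ℂ) * q ^ n)
      (1 - q ^ d)⁻¹ := by
  have hinj : Function.Injective (fun j : ℕ => d * j) := fun a b h => Nat.eq_of_mul_eq_mul_left hd h
  have hqd : ‖q ^ d‖ < 1 := by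
    rw [norm_pow]; exact pow_lt_one₀ (norm_nonneg _) hq hd.ne'
  rw [← hinj.hasSum_iff]
  · convert! hasSum_geometric_of_norm_lt_one hqd using 2 with j
    simp [geomPowerSeries, pow_mul]
  · intro n hn
    have : ¬ d ∣ n := fun ⟨k, hk⟩ => hn ⟨k, hk.symm⟩
    simp [geomPowerSeries, this]

theorem coeff_geomPowerSeries_nonneg (d n : ℕ) :
    0 ≤ PowerSeries.coeff n (geomPowerSeries d) := by
  simp only [geomPowerSeries, PowerSeries.coeff_mk]
  split_ifs <;> norm_num

theorem coeff_truncPartitionSeries_nonneg (K n : ℕ) :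
    0 ≤ PowerSeries.coeff n (truncPartitionSeries K) := by
  induction K generalizing n with
  | zero =>
    simp only [truncPartitionSeries, Finset.range_zero, Finset.prod_empty, PowerSeries.coeff_one]
    split_ifs <;> norm_num
  | succ K ih =>
    rw [truncPartitionSeries_succ, PowerSeries.coeff_mul]
    exact Finset.sum_nonneg fun p _ => mul_nonneg (ih _) (coeff_geomPowerSeries_nonneg _ _)

theorem coeff_truncPartitionSeries_mono (n : ℕ) :
    Monotone fun K => PowerSeries.coeff n (truncPartitionSeries K) := by
  refine monotone_nat_of_le_succ fun K => ?_
  rw [truncPartitionSeries_succ, PowerSeries.coeff_mul]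
  have := Finset.single_le_sum
    (f := fun p : ℕ × ℕ => PowerSeries.coeff p.1 (truncPartitionSeries K) *
      PowerSeries.coeff p.2 (geomPowerSeries (K + 1)))
    (fun p _ => mul_nonneg (coeff_truncPartitionSeries_nonneg K _)
      (coeff_geomPowerSeries_nonneg _ _))
    (show (n, 0) ∈ Finset.HasAntidiagonal.antidiagonal n by simp)
  simpa [geomPowerSeries] using this

theorem hasSum_truncPartitionSeries (K : ℕ) {q : ℂ} (hq : ‖q‖ < 1) :
    HasSum (fun n => ((PowerSeries.coeff n (truncPartitionSeries K) : ℝ) : ℂ) * q ^ n)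
      (∏ i ∈ Finset.range K, (1 - q ^ (i + 1))⁻¹) := by
  induction K with
  | zero =>
    simp only [truncPartitionSeries, Finset.range_zero, Finset.prod_empty, PowerSeries.coeff_one]
    convert! hasSum_ite_eq 0 (1 : ℂ) using 2 with n
    split_ifs with h <;> simp [h]
  | succ K ih =>
    have hg := hasSum_geomPowerSeries (K + 1) K.succ_pos hq
    have h1 := (summable_norm_iff.mpr ih.summable)
    have h2 := (summable_norm_iff.mpr hg.summable)
    have h3 := (summable_norm_sum_mul_antidiagonal_of_summable_norm h1 h2).of_norm.hasSum
    rw [← tsum_mul_tsum_eq_tsum_sum_antidiagonal_of_summable_norm h1 h2, ih.tsum_eq,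
      hg.tsum_eq] at h3
    rw [Finset.prod_range_succ]
    convert! h3 using 2 with n
    rw [truncPartitionSeries_succ, PowerSeries.coeff_mul]
    push_cast
    rw [Finset.sum_mul]
    refine Finset.sum_congr rfl fun p hp => ?_
    rw [← Finset.HasAntidiagonal.mem_antidiagonal.mp hp, pow_add]
    ring

open scoped PowerSeries.WithPiTopology in
theorem tendsto_coeff_truncPartitionSeries (n : ℕ) :
    Tendsto (fun K => PowerSeries.coeff n (truncPartitionSeries K)) atTop
      (𝓝 (partitionFn n : ℝ)) := by
  have h := (Nat.Partition.hasProd_powerSeriesMk_card_restricted ℝ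
    (fun _ => True)).tendsto_prod_nat
  rw [PowerSeries.WithPiTopology.tendsto_iff_coeff_tendsto] at h
  convert! h n using 2 with K
  · rw [truncPartitionSeries]
    congr 1
    refine Finset.prod_congr rfl fun i _ => ?_
    simp [tsum_X_pow_mul (i + 1) i.succ_pos]
  · simp [partitionFn, Nat.Partition.restricted]

theorem coeff_truncPartitionSeries_le (K n : ℕ) :
    PowerSeries.coeff n (truncPartitionSeries K) ≤ partitionFn n :=
  (coeff_truncPartitionSeries_mono n).ge_of_tendsto (tendsto_coeff_truncPartitionSeries n) K

theorem tendsto_prod_inv_one_sub_pow {q : ℂ} (hq : ‖q‖ < 1) :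
    Tendsto (fun K => ∏ i ∈ Finset.range K, (1 - q ^ (i + 1))⁻¹) atTop
      (𝓝 (∏' i : ℕ, (1 - q ^ (i + 1)))⁻¹) := by
  have h := (ModularForm.multipliable_one_sub_pow hq).hasProd.tendsto_prod_nat
  have h0 : ∏' i : ℕ, (1 - q ^ (i + 1)) ≠ 0 := by
    refine tprod_one_add_ne_zero_of_summable (f := fun n ↦ -q ^ (n + 1)) ?_ ?_
    · intro i h
      have h1 : q ^ (i + 1) = 1 := by linear_combination -h
      have h2 : ‖q ^ (i + 1)‖ < 1 := by
        rw [norm_pow]; exact pow_lt_one₀ (norm_nonneg _) hq i.succ_ne_zero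
      rw [h1] at h2
      simp at h2
    · simpa using (summable_nat_add_iff 1).mpr (summable_geometric_of_lt_one (norm_nonneg _) hq)
  simpa only [Finset.prod_inv_distrib] using h.inv₀ h0

theorem summable_partitionFn_mul_pow {r : ℝ} (h0 : 0 ≤ r) (h1 : r < 1) :
    Summable fun n => (partitionFn n : ℝ) * r ^ n := by
  have hq : ‖(r : ℂ)‖ < 1 := by simpa [abs_of_nonneg h0] using h1
  obtain ⟨C, hC⟩ := (tendsto_prod_inv_one_sub_pow hq).norm.bddAbove_range
  refine summable_of_sum_range_le (c := C) (fun n => by positivity) fun M => ?_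
  refine le_of_tendsto (tendsto_finsetSum _ fun n _ =>
    (tendsto_coeff_truncPartitionSeries n).mul_const (r ^ n)) (Eventually.of_forall fun K => ?_)
  have h := hasSum_truncPartitionSeries K hq
  have hs : HasSum (fun n => PowerSeries.coeff n (truncPartitionSeries K) * r ^ n)
      (∏ i ∈ Finset.range K, (1 - r ^ (i + 1))⁻¹) := by
    exact_mod_cast h
  refine (hs.summable.sum_le_tsum _ fun n _ =>
    mul_nonneg (coeff_truncPartitionSeries_nonneg K n) (by positivity)).trans ?_
  rw [hs.tsum_eq]
  refine le_trans (le_of_eq_of_le ?_ (Complex.re_le_norm _)) (hC ⟨K, rfl⟩)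
  rw [← Complex.ofReal_re (∏ i ∈ Finset.range K, (1 - r ^ (i + 1))⁻¹)]
  push_cast
  rfl

/-- The generating function of the partition numbers. -/
noncomputable def partitionGF (q : ℂ) : ℂ := ∑' n : ℕ, (partitionFn n : ℂ) * q ^ n

theorem summable_norm_partitionFn_mul_pow {q : ℂ} (hq : ‖q‖ < 1) :
    Summable fun n => ‖(partitionFn n : ℂ) * q ^ n‖ := by
  simpa using summable_partitionFn_mul_pow (norm_nonneg q) hq

theorem partitionGF_eq_inv_tprod {q : ℂ} (hq : ‖q‖ < 1) :
    partitionGF q = (∏' i : ℕ, (1 - q ^ (i + 1)))⁻¹ := by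
  refine tendsto_nhds_unique ?_ (tendsto_prod_inv_one_sub_pow hq)
  have := tendsto_tsum_of_dominated_convergence (𝓕 := atTop)
    (f := fun K n => ((PowerSeries.coeff n (truncPartitionSeries K) : ℝ) : ℂ) * q ^ n)
    (g := fun n => (partitionFn n : ℂ) * q ^ n)
    (summable_norm_partitionFn_mul_pow hq) (fun n => ?_) (Eventually.of_forall fun K n => ?_)
  · simpa only [partitionGF, (hasSum_truncPartitionSeries _ hq).tsum_eq] using this
  · refine Tendsto.mul_const _ ?_
    exact_mod_cast (Complex.continuous_ofReal.tendsto _).comp (tendsto_coeff_truncPartitionSeries n)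
  · rw [norm_mul, norm_mul, Complex.norm_real, Complex.norm_natCast,
      Real.norm_of_nonneg (coeff_truncPartitionSeries_nonneg K n)]
    exact mul_le_mul_of_nonneg_right (coeff_truncPartitionSeries_le K n) (norm_nonneg _)

theorem sqrt_I_mul {s : ℂ} (hs : 0 < s.re) :
    Complex.sqrt (Complex.I * s) = Complex.sqrt Complex.I * Complex.sqrt s := by
  have hs0 : s ≠ 0 := by rintro rfl; simp at hs
  have harg := abs_lt.mp (Complex.abs_arg_lt_pi_div_two_iff.mpr (Or.inl hs))
  rw [Complex.sqrt, Complex.sqrt, Complex.sqrt, Complex.cpow_def_of_ne_zero (by simp [hs0]),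
    Complex.cpow_def_of_ne_zero Complex.I_ne_zero, Complex.cpow_def_of_ne_zero hs0,
    ← Complex.exp_add, Complex.log_mul Complex.I_ne_zero hs0 (by
      rw [Complex.arg_I]; constructor <;> linarith [Real.pi_pos]), add_mul]

theorem norm_exp_neg_two_pi_mul_lt_one {s : ℂ} (hs : 0 < s.re) :
    ‖Complex.exp (-2 * Real.pi * s)‖ < 1 := by
  rw [Complex.norm_exp, Real.exp_lt_one_iff]
  simp
  positivity

theorem re_inv_pos {s : ℂ} (hs : 0 < s.re) : 0 < (s⁻¹).re := by
  rw [Complex.inv_re]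
  exact div_pos hs (Complex.normSq_pos.mpr (by rintro rfl; simp at hs))

theorem partitionGF_exp_mul_eta {s : ℂ} (hs : 0 < s.re) :
    partitionGF (Complex.exp (-2 * Real.pi * s)) * ModularForm.eta (Complex.I * s) =
      Complex.exp (-Real.pi * s / 12) := by
  have hz : 0 < (Complex.I * s).im := by simpa
  have h0 := ModularForm.eta_tprod_ne_zero hz
  rw [partitionGF_eq_inv_tprod (norm_exp_neg_two_pi_mul_lt_one hs), ModularForm.eta]
  have h1 : ∏' n, (1 - ModularForm.eta_q n (Complex.I * s)) =
      ∏' i : ℕ, (1 - Complex.exp (-2 * Real.pi * s) ^ (i + 1)) := by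
    refine tprod_congr fun n => ?_
    rw [ModularForm.eta_q_eq_pow]
    congr 3
    linear_combination (2 * Real.pi * s) * Complex.I_sq
  rw [h1] at h0 ⊢
  rw [mul_left_comm, inv_mul_cancel₀ h0, mul_one, Function.Periodic.qParam]
  congr 1
  push_cast
  linear_combination (2 * Real.pi * s / 24) * Complex.I_sq

/-- The modular transformation of the generating function of the partition numbers. -/
theorem partitionGF_exp_eq {s : ℂ} (hs : 0 < s.re) :
    partitionGF (Complex.exp (-2 * Real.pi * s)) =
      Complex.exp (-Real.pi * s / 12) * Complex.sqrt s * Complex.exp (Real.pi / 12 / s) *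
        partitionGF (Complex.exp (-2 * Real.pi * s⁻¹)) := by
  have hs0 : s ≠ 0 := by rintro rfl; simp at hs
  have hz : 0 < (Complex.I * s).im := by simpa
  have h1 := partitionGF_exp_mul_eta hs
  have h2 := partitionGF_exp_mul_eta (re_inv_pos hs)
  have h3 := ModularForm.eta_comp_eq_csqrt_I_inv hz
  have hI : Complex.sqrt Complex.I ≠ 0 := by simp [Complex.sqrt]
  have hsq : Complex.sqrt s ≠ 0 := by simp [Complex.sqrt, hs0]
  have h4 : -1 / (Complex.I * s) = Complex.I * s⁻¹ := by
    field_simp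
    rw [Complex.I_sq]
  simp only [Function.comp, Pi.smul_apply, Pi.mul_apply, smul_eq_mul, h4, sqrt_I_mul hs,
    ← mul_assoc, inv_mul_cancel₀ hI, one_mul] at h3
  rw [h3] at h2
  have h5 : Complex.exp (-Real.pi * s⁻¹ / 12) * Complex.exp (Real.pi / 12 / s) = 1 := by
    rw [← Complex.exp_add, Complex.exp_eq_one_iff]
    exact ⟨0, by field_simp; ring⟩
  have h6 : ModularForm.eta (Complex.I * s) ≠ 0 := ModularForm.eta_ne_zero hz
  apply mul_right_cancel₀ h6
  rw [h1]
  linear_combination (-Complex.exp (-Real.pi * s / 12)) * h5 -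
    (Complex.exp (-Real.pi * s / 12) * Complex.exp (Real.pi / 12 / s)) * h2

theorem exists_norm_partitionGF_sub_one_le {r : ℝ} (h0 : 0 < r) (h1 : r < 1) :
    ∃ C : ℝ, 0 ≤ C ∧ ∀ q : ℂ, ‖q‖ ≤ r → ‖partitionGF q - 1‖ ≤ C * ‖q‖ := by
  have hs := summable_partitionFn_mul_pow h0.le h1
  have hs' : Summable fun n => (partitionFn (n + 1) : ℝ) * r ^ n := by
    refine (((summable_nat_add_iff 1).mpr hs).mul_right r⁻¹).congr fun n => ?_
    field_simp
    ring
  refine ⟨∑' n, (partitionFn (n + 1) : ℝ) * r ^ n, tsum_nonneg fun n => by positivity,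
    fun q hq => ?_⟩
  have hsq := summable_norm_partitionFn_mul_pow (hq.trans_lt h1)
  have hp0 : partitionFn 0 = 1 := by simp [partitionFn]
  rw [partitionGF, hsq.of_norm.tsum_eq_zero_add, hp0, Nat.cast_one, pow_zero, mul_one,
    add_sub_cancel_left, ← tsum_mul_right]
  refine tsum_of_norm_bounded (hs'.mul_right ‖q‖).hasSum fun n => ?_
  rw [norm_mul, norm_pow, Complex.norm_natCast, pow_succ, ← mul_assoc]
  gcongr

theorem one_sub_norm_mul_exp_le {w : ℂ} (hw : ‖w‖ < 1) :
    (1 - ‖w‖) * Real.exp ‖w‖ ≤ ‖1 - w‖ * Real.exp w.re := by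
  have hw' : ‖((‖w‖ : ℝ) : ℂ)‖ < 1 := by simpa using hw
  have h1 := Complex.hasSum_re (Complex.hasSum_taylorSeries_neg_log hw)
  have h2 := Complex.hasSum_re (Complex.hasSum_taylorSeries_neg_log hw')
  have h3 := le_hasSum (h2.sub h1) 1 fun n _ => by
    rw [sub_nonneg]
    have h4 : ((‖w‖ : ℝ) : ℂ) ^ n / n = ((‖w‖ ^ n / n : ℝ) : ℂ) := by push_cast; rfl
    rw [h4, Complex.ofReal_re]
    refine (Complex.re_le_norm _).trans ?_
    simp
  have h5 : 0 < ‖1 - w‖ := norm_pos_iff.mpr (sub_ne_zero.mpr (by rintro rfl; simp at hw))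
  have h6 : 0 < 1 - ‖w‖ := by linarith
  have h7 : ‖(1 : ℂ) - (‖w‖ : ℝ)‖ = 1 - ‖w‖ := by
    rw [← Complex.ofReal_one, ← Complex.ofReal_sub, Complex.norm_real, Real.norm_of_nonneg h6.le]
  simp only [pow_one, Nat.cast_one, div_one, Complex.ofReal_re, Complex.neg_re, Complex.log_re,
    h7] at h3
  rw [← Real.exp_log h5, ← Real.exp_log h6, ← Real.exp_add, ← Real.exp_add, Real.exp_le_exp]
  linarith

theorem norm_partitionGF_le {q : ℂ} (hq : ‖q‖ < 1) :
    ‖partitionGF q‖ ≤ ‖partitionGF (‖q‖ : ℝ)‖ *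
      Real.exp ((q / (1 - q)).re - ‖q‖ / (1 - ‖q‖)) := by
  have hq' : ‖((‖q‖ : ℝ) : ℂ)‖ < 1 := by simpa using hq
  have hsum : ∀ {z : ℂ}, ‖z‖ < 1 → Tendsto (fun K => ∑ i ∈ Finset.range K, z ^ (i + 1)) atTop
      (𝓝 (z / (1 - z))) := fun {z} hz => by
    have := ((hasSum_geometric_of_norm_lt_one hz).mul_right z).tendsto_sum_nat
    simpa only [← pow_succ, div_eq_inv_mul] using this
  rw [partitionGF_eq_inv_tprod hq, partitionGF_eq_inv_tprod hq']
  have hre : ‖q‖ / (1 - ‖q‖) = ((((‖q‖ : ℝ) : ℂ)) / (1 - (‖q‖ : ℝ))).re := by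
    rw [← Complex.ofReal_one, ← Complex.ofReal_sub, ← Complex.ofReal_div, Complex.ofReal_re]
  rw [hre]
  refine le_of_tendsto_of_tendsto' (tendsto_prod_inv_one_sub_pow hq).norm
    ((tendsto_prod_inv_one_sub_pow hq').norm.mul ((Real.continuous_exp.tendsto _).comp
      (((Complex.continuous_re.tendsto _).comp (hsum hq)).sub
        ((Complex.continuous_re.tendsto _).comp (hsum hq'))))) fun K => ?_
  simp only [Function.comp, Complex.re_sum, ← Finset.sum_sub_distrib, Real.exp_sum, norm_prod,
    ← Finset.prod_mul_distrib, norm_inv]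
  refine Finset.prod_le_prod (fun i _ => by positivity) fun i _ => ?_
  have hqi : ‖q ^ (i + 1)‖ < 1 := by
    rw [norm_pow]; exact pow_lt_one₀ (norm_nonneg _) hq i.succ_ne_zero
  have h1 := one_sub_norm_mul_exp_le hqi
  have h2 : ‖1 - ((‖q‖ : ℝ) : ℂ) ^ (i + 1)‖ = 1 - ‖q ^ (i + 1)‖ := by
    rw [← Complex.ofReal_pow, ← norm_pow, ← Complex.ofReal_one, ← Complex.ofReal_sub,
      Complex.norm_real, Real.norm_of_nonneg (by linarith)]
  have h3 : 0 < ‖1 - q ^ (i + 1)‖ :=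
    norm_pos_iff.mpr (sub_ne_zero.mpr fun h => by simp [← h] at hqi)
  have h4 : (((‖q‖ : ℝ) : ℂ) ^ (i + 1)).re = ‖q ^ (i + 1)‖ := by
    rw [← Complex.ofReal_pow, Complex.ofReal_re, norm_pow]
  rw [h2, h4, Real.exp_sub, inv_le_iff_one_le_mul₀ h3, ← div_eq_inv_mul, div_div,
    div_mul_eq_mul_div, one_le_div (mul_pos (Real.exp_pos _) (by linarith))]
  linarith

theorem norm_sqrt_le_one {s : ℂ} (hs : ‖s‖ ≤ 1) : ‖Complex.sqrt s‖ ≤ 1 := by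
  have h : Complex.sqrt s ^ 2 = s := Complex.cpow_nat_inv_pow s two_ne_zero
  rw [← sq_le_one_iff₀ (norm_nonneg _), ← norm_pow, h]
  exact hs

theorem norm_exp_div_eq (a : ℝ) (s : ℂ) :
    ‖Complex.exp (a / s)‖ = Real.exp (a * (s.re / ‖s‖ ^ 2)) := by
  rw [Complex.norm_exp, div_eq_mul_inv, Complex.re_ofReal_mul, Complex.inv_re,
    Complex.normSq_eq_norm_sq]

theorem norm_partitionGF_exp_real_le {C y : ℝ}
    (hC : ∀ q : ℂ, ‖q‖ ≤ Real.exp (-Real.pi) → ‖partitionGF q - 1‖ ≤ C * ‖q‖) (hC0 : 0 ≤ C)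
    (hy0 : 0 < y) (hy : y ≤ 1) :
    ‖partitionGF (Real.exp (-2 * Real.pi * y) : ℝ)‖ ≤ (1 + C) * Real.exp (Real.pi / 12 / y) := by
  have hpi := Real.pi_pos
  have hs : 0 < (y : ℂ).re := by simpa
  have h := partitionGF_exp_eq hs
  have h1 : ‖Complex.exp (-2 * Real.pi * (y : ℂ)⁻¹)‖ ≤ Real.exp (-Real.pi) := by
    have : (-2 * Real.pi * (y : ℂ)⁻¹) = ((-2 * Real.pi * y⁻¹ : ℝ) : ℂ) := by push_cast; rfl
    rw [this, Complex.norm_exp, Complex.ofReal_re, Real.exp_le_exp]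
    have : 1 ≤ y⁻¹ := (one_le_inv₀ hy0).mpr hy
    nlinarith
  have h2 : ‖partitionGF (Complex.exp (-2 * Real.pi * (y : ℂ)⁻¹))‖ ≤ 1 + C := by
    have h3 := hC _ h1
    have h4 := norm_le_norm_add_norm_sub' (partitionGF (Complex.exp (-2 * Real.pi * (y : ℂ)⁻¹))) 1
    have h5 : Real.exp (-Real.pi) ≤ 1 := Real.exp_le_one_iff.mpr (by linarith)
    rw [norm_one] at h4
    nlinarith
  have h6 : ‖Complex.exp (Real.pi / 12 / y)‖ = Real.exp (Real.pi / 12 / y) := by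
    rw [Complex.norm_exp]; norm_cast
  have h7 : ‖Complex.exp (-Real.pi * y / 12)‖ ≤ 1 := by
    rw [Complex.norm_exp, Real.exp_le_one_iff]; norm_cast; rw [neg_mul, neg_div]
    simp only [Left.neg_nonpos_iff]; positivity
  have h8 : ‖Complex.sqrt y‖ ≤ 1 := norm_sqrt_le_one (by simpa [abs_of_pos hy0] using hy)
  push_cast at h ⊢
  rw [h, norm_mul, norm_mul, norm_mul, h6, mul_comm (1 + C)]
  have h9 : ‖Complex.exp (-Real.pi * y / 12)‖ * ‖Complex.sqrt y‖ ≤ 1 :=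
    mul_le_one₀ h7 (norm_nonneg _) h8
  calc _ ≤ 1 * Real.exp (Real.pi / 12 / y) * (1 + C) := by gcongr
    _ = _ := by ring

theorem sq_le_norm_one_sub_exp_sq {x y : ℝ} (hy0 : 0 < y) (hy : y ≤ 1 / 16) (hx : |x| ≤ 1 / 2) :
    x ^ 2 ≤ ‖1 - Complex.exp (-2 * Real.pi * (y + x * Complex.I))‖ ^ 2 := by
  have hpi := Real.pi_pos
  have hpi4 := Real.pi_le_four
  have hcos : Real.cos (2 * Real.pi * x) ≤ 1 - 8 * x ^ 2 := by
    have h := Real.cos_le_one_sub_mul_cos_sq (x := 2 * Real.pi * x) (by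
      rw [abs_mul, abs_of_pos (by positivity)]; nlinarith)
    convert h using 1
    field_simp
    ring
  have hr : 1 / 2 ≤ Real.exp (-2 * Real.pi * y) := by
    have := Real.add_one_le_exp (-2 * Real.pi * y)
    nlinarith
  set r := Real.exp (-2 * Real.pi * y) with hr_def
  have hq : Complex.exp (-2 * Real.pi * (y + x * Complex.I)) =
      ⟨r * Real.cos (2 * Real.pi * x), -(r * Real.sin (2 * Real.pi * x))⟩ := by
    apply Complex.ext
    · rw [Complex.exp_re]
      simp [hr_def]
    · rw [Complex.exp_im]
      simp [hr_def]
  rw [hq, ← Complex.normSq_eq_norm_sq, Complex.normSq_apply]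
  simp only [Complex.sub_re, Complex.sub_im, Complex.one_re, Complex.one_im]
  have hsc := Real.sin_sq_add_cos_sq (2 * Real.pi * x)
  have : (1 - r * Real.cos (2 * Real.pi * x)) * (1 - r * Real.cos (2 * Real.pi * x)) +
      (0 - -(r * Real.sin (2 * Real.pi * x))) * (0 - -(r * Real.sin (2 * Real.pi * x))) =
      (1 - r) ^ 2 + 2 * r * (1 - Real.cos (2 * Real.pi * x)) := by
    linear_combination r ^ 2 * hsc
  rw [this]
  nlinarith [sq_nonneg (1 - r), sq_nonneg x]

/-- The principal part of the generating function of the partition numbers near the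
singularity at `1`. -/
noncomputable def partitionGFMain (s : ℂ) : ℂ :=
  Complex.exp (-Real.pi * s / 12) * Complex.sqrt s * Complex.exp (Real.pi / 12 / s)

theorem norm_partitionGFMain_le {s : ℂ} (hs : 0 < s.re) (hs1 : ‖s‖ ≤ 1) :
    ‖partitionGFMain s‖ ≤ Real.exp (Real.pi / 12 * (s.re / ‖s‖ ^ 2)) := by
  have hpi := Real.pi_pos
  have h1 : ‖Complex.exp (-Real.pi * s / 12)‖ ≤ 1 := by
    rw [Complex.norm_exp, Real.exp_le_one_iff]
    have : (-Real.pi * s / 12) = ((-Real.pi / 12 : ℝ) : ℂ) * s := by push_cast; ring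
    rw [this, Complex.re_ofReal_mul]
    have : 0 < Real.pi / 12 * s.re := by positivity
    linarith
  have h2 := norm_exp_div_eq (Real.pi / 12) s
  push_cast at h2
  rw [partitionGFMain, norm_mul, norm_mul, h2]
  exact mul_le_of_le_one_left (Real.exp_nonneg _)
    (mul_le_one₀ h1 (norm_nonneg _) (norm_sqrt_le_one hs1))

theorem norm_partitionGF_sub_main_le_of_near {C : ℝ} {s : ℂ}
    (hC : ∀ q : ℂ, ‖q‖ ≤ Real.exp (-Real.pi) → ‖partitionGF q - 1‖ ≤ C * ‖q‖) (hC0 : 0 ≤ C)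
    (hs : 0 < s.re) (hs1 : ‖s‖ ≤ 1) (hs2 : ‖s‖ ^ 2 ≤ 2 * s.re) :
    ‖partitionGF (Complex.exp (-2 * Real.pi * s)) - partitionGFMain s‖ ≤ C := by
  have hpi := Real.pi_pos
  have hspos : 0 < ‖s‖ ^ 2 := by
    have : s ≠ 0 := by rintro rfl; simp at hs
    positivity
  have hq : ‖Complex.exp (-2 * Real.pi * s⁻¹)‖ = Real.exp (-2 * Real.pi * (s.re / ‖s‖ ^ 2)) := by
    rw [← norm_exp_div_eq, div_eq_mul_inv]; push_cast; rfl
  have hratio : 1 / 2 ≤ s.re / ‖s‖ ^ 2 := by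
    rw [div_le_div_iff₀ two_pos hspos]; linarith
  have h1 := hC (Complex.exp (-2 * Real.pi * s⁻¹)) (by
    rw [hq, Real.exp_le_exp]; nlinarith)
  rw [hq] at h1
  have h2 := norm_partitionGFMain_le hs hs1
  rw [partitionGF_exp_eq hs, ← partitionGFMain, ← mul_sub_one, norm_mul]
  calc _ ≤ Real.exp (Real.pi / 12 * (s.re / ‖s‖ ^ 2)) *
        (C * Real.exp (-2 * Real.pi * (s.re / ‖s‖ ^ 2))) := by gcongr
    _ = C * Real.exp (-(23 / 12 * Real.pi * (s.re / ‖s‖ ^ 2))) := by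
      rw [mul_left_comm, ← Real.exp_add]; ring_nf
    _ ≤ C * 1 := by
      gcongr
      rw [Real.exp_le_one_iff, Left.neg_nonpos_iff]
      positivity
    _ = C := mul_one C

theorem norm_sq_add_mul_I (α v : ℝ) : ‖(α + v * Complex.I : ℂ)‖ ^ 2 = α ^ 2 + v ^ 2 := by
  rw [← Complex.normSq_eq_norm_sq, Complex.normSq_apply]
  simp
  ring

theorem exists_norm_partitionGF_sub_main_le :
    ∃ C : ℝ, 0 ≤ C ∧ ∀ x y : ℝ, 0 < y → y ≤ 1 / 16 → |x| ≤ 1 / 2 →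
      ‖partitionGF (Complex.exp (-2 * Real.pi * (y + x * Complex.I))) -
        partitionGFMain (y + x * Complex.I)‖ ≤
      C * Real.exp (Real.pi / 12 / y - 1 / (4 * Real.pi * y)) := by
  have hpi := Real.pi_pos
  have hpi3 := Real.pi_gt_three
  obtain ⟨C, hC0, hC⟩ := exists_norm_partitionGF_sub_one_le (Real.exp_pos (-Real.pi))
    (Real.exp_lt_one_iff.mpr (by linarith))
  refine ⟨C + ((1 + C) * Real.exp (Real.pi + 1) + Real.exp (Real.pi / 12)), by positivity,
    fun x y hy0 hy hx => ?_⟩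
  have hE : 1 ≤ Real.exp (Real.pi / 12 / y - 1 / (4 * Real.pi * y)) := by
    rw [Real.one_le_exp_iff, sub_nonneg, div_div, div_le_div_iff₀ (by positivity) (by positivity)]
    nlinarith [mul_pos hpi hy0, mul_pos hpi (mul_pos hpi hy0)]
  set s : ℂ := y + x * Complex.I with hs_def
  have hsre : s.re = y := by simp [hs_def]
  have hsnorm : ‖s‖ ^ 2 = y ^ 2 + x ^ 2 := norm_sq_add_mul_I y x
  have hx2 : x ^ 2 ≤ 1 / 4 := by
    rw [← sq_abs]; nlinarith [abs_nonneg x]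
  have hs1 : ‖s‖ ≤ 1 := by
    rw [← sq_le_one_iff₀ (norm_nonneg _), hsnorm]; nlinarith
  have hs : 0 < s.re := hsre ▸ hy0
  rcases le_or_gt (x ^ 2) y with hxy | hxy
  · refine (norm_partitionGF_sub_main_le_of_near hC hC0 hs hs1 ?_).trans ?_
    · rw [hsnorm, hsre]; nlinarith
    · have : 0 ≤ (1 + C) * Real.exp (Real.pi + 1) + Real.exp (Real.pi / 12) := by positivity
      nlinarith
  have hq1 := norm_exp_neg_two_pi_mul_lt_one hs
  have hqn : ‖Complex.exp (-2 * Real.pi * s)‖ = Real.exp (-2 * Real.pi * y) := by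
    rw [Complex.norm_exp, ← hsre, ← Complex.re_ofReal_mul]; push_cast; rfl
  have h1 := norm_partitionGF_le hq1
  have h2 := sq_le_norm_one_sub_exp_sq hy0 hy hx
  rw [← hs_def] at h2
  set q := Complex.exp (-2 * Real.pi * s)
  rw [hqn] at h1
  have hr1 : Real.exp (-2 * Real.pi * y) < 1 := hqn ▸ hq1
  have h3 := norm_partitionGF_exp_real_le hC hC0 hy0 (by linarith)
  have hsy : 0 < Real.sqrt y := Real.sqrt_pos.mpr hy0
  have h4 : Real.sqrt y ≤ ‖1 - q‖ :=
    Real.sqrt_le_iff.mpr ⟨norm_nonneg _, hxy.le.trans h2⟩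
  have h5 : (q / (1 - q)).re ≤ 1 / Real.sqrt y := by
    refine (Complex.re_le_norm _).trans ?_
    rw [norm_div]
    exact div_le_div₀ zero_le_one hq1.le hsy h4
  have h6 : 1 / (2 * Real.pi * y) - 1 ≤
      Real.exp (-2 * Real.pi * y) / (1 - Real.exp (-2 * Real.pi * y)) := by
    have h7 := Real.add_one_le_exp (-2 * Real.pi * y)
    have h8 : 0 < 1 - Real.exp (-2 * Real.pi * y) := by linarith
    have h9 : Real.exp (-2 * Real.pi * y) / (1 - Real.exp (-2 * Real.pi * y)) =
        1 / (1 - Real.exp (-2 * Real.pi * y)) - 1 := by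
      rw [eq_sub_iff_add_eq, div_add_one h8.ne', add_sub_cancel]
    rw [h9]
    gcongr
    linarith
  have h7 : 1 / Real.sqrt y ≤ 1 / (4 * Real.pi * y) + Real.pi := by
    have h8 : 1 / (4 * Real.pi * y) = (1 / Real.sqrt y) ^ 2 / (4 * Real.pi) := by
      rw [div_pow, Real.sq_sqrt hy0.le]; field_simp
    rw [h8, div_add' _ _ _ (by positivity), le_div_iff₀ (by positivity)]
    nlinarith [sq_nonneg (1 / Real.sqrt y - 2 * Real.pi)]
  have h8 : 1 / (2 * Real.pi * y) = 2 * (1 / (4 * Real.pi * y)) := by field_simp; norm_num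
  have hF : ‖partitionGF q‖ ≤ (1 + C) * Real.exp (Real.pi + 1) *
      Real.exp (Real.pi / 12 / y - 1 / (4 * Real.pi * y)) := by
    refine h1.trans ?_
    calc _ ≤ (1 + C) * Real.exp (Real.pi / 12 / y) *
          Real.exp (Real.pi + 1 - 1 / (4 * Real.pi * y)) := by
          exact mul_le_mul h3 (Real.exp_le_exp.mpr (by linarith)) (Real.exp_nonneg _)
            (by positivity)
      _ = _ := by
          have h10 : Real.exp (Real.pi / 12 / y) *
              Real.exp (Real.pi + 1 - 1 / (4 * Real.pi * y)) = Real.exp (Real.pi + 1) *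
              Real.exp (Real.pi / 12 / y - 1 / (4 * Real.pi * y)) := by
            rw [← Real.exp_add, ← Real.exp_add]
            ring_nf
          linear_combination (1 + C) * h10
  have hM : ‖partitionGFMain s‖ ≤ Real.exp (Real.pi / 12) := by
    refine (norm_partitionGFMain_le hs hs1).trans ?_
    rw [Real.exp_le_exp]
    refine mul_le_of_le_one_right (by positivity) ?_
    rw [hsnorm, hsre, div_le_one (by positivity)]
    nlinarith
  refine (norm_sub_le _ _).trans ?_
  nlinarith [Real.exp_pos (Real.pi / 12),
    mul_le_mul_of_nonneg_left hE (Real.exp_pos (Real.pi / 12)).le]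

theorem integral_exp_int_mul (k : ℤ) :
    ∫ x in (-1 / 2 : ℝ)..(1 / 2), Complex.exp (2 * Real.pi * Complex.I * k * x) =
      if k = 0 then 1 else 0 := by
  split_ifs with hk
  · subst hk
    norm_num
  · have hc : (2 * Real.pi * Complex.I * k : ℂ) ≠ 0 := by
      simp [hk]
    rw [integral_exp_mul_complex hc, div_eq_zero_iff, sub_eq_zero]
    left
    rw [Complex.exp_eq_exp_iff_exists_int]
    exact ⟨k, by push_cast; ring⟩

theorem norm_partitionFn_mul_exp_pow (y x : ℝ) (m : ℕ) :
    ‖(partitionFn m : ℂ) * Complex.exp (-2 * Real.pi * (y + x * Complex.I)) ^ m‖ =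
      (partitionFn m : ℝ) * Real.exp (-2 * Real.pi * y) ^ m := by
  rw [norm_mul, norm_pow, Complex.norm_exp]
  simp

theorem norm_exp_mul_add_mul_I (c y x : ℝ) :
    ‖Complex.exp (c * (y + x * Complex.I))‖ = Real.exp (c * y) := by
  rw [Complex.norm_exp]
  simp

theorem summable_partitionFn_mul_exp_pow {y : ℝ} (hy : 0 < y) :
    Summable fun m : ℕ => (partitionFn m : ℝ) * Real.exp (-2 * Real.pi * y) ^ m :=
  summable_partitionFn_mul_pow (Real.exp_nonneg _) (Real.exp_lt_one_iff.mpr (by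
    have := mul_pos Real.pi_pos hy
    linarith))

theorem continuous_partitionGF_exp {y : ℝ} (hy : 0 < y) :
    Continuous fun x : ℝ => partitionGF (Complex.exp (-2 * Real.pi * (y + x * Complex.I))) :=
  continuous_tsum (fun m => by fun_prop) (summable_partitionFn_mul_exp_pow hy)
    fun m x => (norm_partitionFn_mul_exp_pow y x m).le

theorem partitionFn_eq_integral {y : ℝ} (hy : 0 < y) (n : ℕ) :
    (partitionFn n : ℂ) = ∫ x in (-1 / 2 : ℝ)..(1 / 2),
      partitionGF (Complex.exp (-2 * Real.pi * (y + x * Complex.I))) *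
        Complex.exp ((2 * Real.pi * n : ℝ) * (y + x * Complex.I)) := by
  have hsum := summable_partitionFn_mul_exp_pow hy
  have key := intervalIntegral.hasSum_integral_of_dominated_convergence (μ := MeasureTheory.volume)
    (a := (-1 / 2 : ℝ)) (b := 1 / 2)
    (F := fun (m : ℕ) (x : ℝ) =>
      (partitionFn m : ℂ) * Complex.exp (-2 * Real.pi * (y + x * Complex.I)) ^ m *
        Complex.exp ((2 * Real.pi * n : ℝ) * (y + x * Complex.I)))
    (f := fun x : ℝ => partitionGF (Complex.exp (-2 * Real.pi * (y + x * Complex.I))) *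
        Complex.exp ((2 * Real.pi * n : ℝ) * (y + x * Complex.I)))
    (fun m _ => (partitionFn m : ℝ) * Real.exp (-2 * Real.pi * y) ^ m *
      Real.exp (2 * Real.pi * n * y))
    (fun m => Continuous.aestronglyMeasurable (by fun_prop))
    (fun m => Eventually.of_forall fun x _ => by
      rw [norm_mul, norm_partitionFn_mul_exp_pow, norm_exp_mul_add_mul_I])
    (Eventually.of_forall fun _ _ => hsum.mul_right _)
    intervalIntegrable_const
    (Eventually.of_forall fun x _ => by
      refine HasSum.mul_right _ (Summable.hasSum (Summable.of_norm ?_))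
      simpa only [norm_partitionFn_mul_exp_pow] using hsum)
  have hterm (m : ℕ) : ∫ x in (-1 / 2 : ℝ)..(1 / 2),
      (partitionFn m : ℂ) * Complex.exp (-2 * Real.pi * (y + x * Complex.I)) ^ m *
        Complex.exp ((2 * Real.pi * n : ℝ) * (y + x * Complex.I)) =
      if m = n then (partitionFn n : ℂ) else 0 := by
    have hF (x : ℝ) : (partitionFn m : ℂ) *
        Complex.exp (-2 * Real.pi * (y + x * Complex.I)) ^ m *
        Complex.exp ((2 * Real.pi * n : ℝ) * (y + x * Complex.I)) =
        (partitionFn m * Complex.exp (2 * Real.pi * ((n : ℂ) - m) * y)) *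
          Complex.exp (2 * Real.pi * Complex.I * ((n - m : ℤ) : ℂ) * x) := by
      rw [← Complex.exp_nat_mul, mul_assoc (partitionFn m : ℂ), mul_assoc (partitionFn m : ℂ),
        ← Complex.exp_add, ← Complex.exp_add]
      push_cast
      ring_nf
    simp_rw [hF]
    rw [intervalIntegral.integral_const_mul, integral_exp_int_mul]
    by_cases h : m = n
    · subst h
      simp
    · have : (n - m : ℤ) ≠ 0 := by omega
      simp [h, this]
  simp_rw [hterm] at key
  rw [← key.tsum_eq, tsum_ite_eq]

theorem continuous_partitionGFMain {y : ℝ} (hy : 0 < y) :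
    Continuous fun x : ℝ => partitionGFMain (y + x * Complex.I) := by
  refine continuous_iff_continuousAt.mpr fun x => ?_
  have hs : 0 < (y + x * Complex.I : ℂ).re := by simpa using hy
  have hs0 : (y + x * Complex.I : ℂ) ≠ 0 := by
    intro h
    rw [h] at hs
    simp at hs
  have h : ContinuousAt partitionGFMain (y + x * Complex.I) := by
    have := (Complex.differentiableAt_sqrt (Or.inl hs)).continuousAt
    unfold partitionGFMain
    fun_prop (disch := assumption)
  exact ContinuousAt.comp (f := fun x : ℝ => (y + x * Complex.I : ℂ)) h (by fun_prop)

theorem exists_norm_partitionFn_sub_integral_le :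
    ∃ C : ℝ, 0 ≤ C ∧ ∀ (n : ℕ) (y : ℝ), 0 < y → y ≤ 1 / 16 →
      ‖(partitionFn n : ℂ) - ∫ x in (-1 / 2 : ℝ)..(1 / 2), partitionGFMain (y + x * Complex.I) *
        Complex.exp ((2 * Real.pi * n : ℝ) * (y + x * Complex.I))‖ ≤
      C * Real.exp (Real.pi / 12 / y - 1 / (4 * Real.pi * y) + 2 * Real.pi * n * y) := by
  obtain ⟨C, hC0, hC⟩ := exists_norm_partitionGF_sub_main_le
  refine ⟨C, hC0, fun n y hy0 hy => ?_⟩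
  have h1 := continuous_partitionGF_exp hy0
  have h2 := continuous_partitionGFMain hy0
  rw [partitionFn_eq_integral hy0, ← intervalIntegral.integral_sub
    (Continuous.intervalIntegrable (by fun_prop) _ _)
    (Continuous.intervalIntegrable (by fun_prop) _ _)]
  refine (intervalIntegral.norm_integral_le_of_norm_le_const (C := C * Real.exp
    (Real.pi / 12 / y - 1 / (4 * Real.pi * y) + 2 * Real.pi * n * y)) fun x hx => ?_).trans ?_
  · rw [← sub_mul, norm_mul, norm_exp_mul_add_mul_I, Real.exp_add, ← mul_assoc]
    refine mul_le_mul_of_nonneg_right (hC x y hy0 hy ?_) (Real.exp_nonneg _)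
    rw [Set.uIoc_of_le (by norm_num)] at hx
    exact abs_le.mpr ⟨by linarith [hx.1], hx.2⟩
  · norm_num

theorem mem_ball_self_of_sq_norm_lt {R : ℝ} {s : ℂ} (hR : 0 < R) (h : ‖s‖ ^ 2 < 2 * R * s.re) :
    s ∈ Metric.ball (R : ℂ) R := by
  rw [mem_ball_iff_norm, ← sq_lt_sq₀ (norm_nonneg _) hR.le, ← Complex.normSq_eq_norm_sq,
    Complex.normSq_apply]
  rw [← Complex.normSq_eq_norm_sq, Complex.normSq_apply] at h
  simp only [Complex.sub_re, Complex.sub_im, Complex.ofReal_re, Complex.ofReal_im]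
  nlinarith

theorem re_pos_of_mem_ball_self {R : ℝ} {s : ℂ} (h : s ∈ Metric.ball (R : ℂ) R) : 0 < s.re := by
  rw [mem_ball_iff_norm] at h
  have h1 := (Complex.abs_re_le_norm (s - R)).trans_lt h
  rw [Complex.sub_re, Complex.ofReal_re] at h1
  linarith [(abs_lt.mp h1).1]

/-- The integrand of a Bessel-type integral after the substitution `s = t ^ 2`. -/
noncomputable def besselIntegrand (a b : ℝ) (t : ℂ) : ℂ :=
  t ^ 2 * Complex.exp (a / t ^ 2 + b * t ^ 2)

theorem ofReal_add_mul_I_ne_zero {α : ℝ} (hα : 0 < α) (v : ℝ) : (α + v * Complex.I : ℂ) ≠ 0 := by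
  intro h
  have := congrArg Complex.re h
  simp [hα.ne'] at this

theorem continuous_besselIntegrand {α : ℝ} (a b : ℝ) (hα : 0 < α) :
    Continuous fun v : ℝ => besselIntegrand a b (α + v * Complex.I) := by
  have h (v : ℝ) : (α + v * Complex.I : ℂ) ^ 2 ≠ 0 := pow_ne_zero 2 (ofReal_add_mul_I_ne_zero hα v)
  unfold besselIntegrand
  fun_prop (disch := assumption)

theorem integral_sqrt_mul_exp_eq {a b y α β : ℝ} (hy : 0 < y) (hα : 0 < α) (hβ : 0 < β)
    (h1 : α ^ 2 - β ^ 2 = y) (h2 : α * β = 1 / 4) :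
    ∫ x in (-1 / 2 : ℝ)..(1 / 2), Complex.sqrt (y + x * Complex.I) *
      Complex.exp (a / (y + x * Complex.I) + b * (y + x * Complex.I)) =
    2 * ∫ v in -β..β, besselIntegrand a b (α + v * Complex.I) := by
  set h : ℂ → ℂ := fun s => Complex.sqrt s * Complex.exp (a / s + b * s) with h_def
  set R := (y ^ 2 + 1 / 4) / y with hR_def
  have hR : 0 < R := by positivity
  have hRy : R * y = y ^ 2 + 1 / 4 := by rw [hR_def]; field_simp
  have hd : DifferentiableOn ℂ h (Metric.ball (R : ℂ) R) := by
    intro s hs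
    have hs0 := re_pos_of_mem_ball_self hs
    have hs1 : s ≠ 0 := by rintro rfl; simp at hs0
    have := Complex.differentiableAt_sqrt (Or.inl hs0)
    refine DifferentiableAt.differentiableWithinAt ?_
    fun_prop (disch := assumption)
  obtain ⟨W, hW⟩ := hd.isExactOn_ball
  have hline (x : ℝ) (hx : x ∈ Set.uIcc (-1 / 2 : ℝ) (1 / 2)) :
      (y + x * Complex.I : ℂ) ∈ Metric.ball (R : ℂ) R := by
    rw [Set.uIcc_of_le (by norm_num)] at hx
    refine mem_ball_self_of_sq_norm_lt hR ?_
    rw [norm_sq_add_mul_I]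
    simp
    nlinarith [hx.1, hx.2]
  have hcurve (v : ℝ) (hv : v ∈ Set.uIcc (-β) β) :
      ((α + v * Complex.I) ^ 2 : ℂ) ∈ Metric.ball (R : ℂ) R := by
    rw [Set.uIcc_of_le (by linarith)] at hv
    refine mem_ball_self_of_sq_norm_lt hR ?_
    have hv2 : v ^ 2 ≤ β ^ 2 := sq_le_sq' hv.1 hv.2
    have hre : ((α + v * Complex.I) ^ 2 : ℂ).re = α ^ 2 - v ^ 2 := by
      simp [sq]
    rw [norm_pow, norm_sq_add_mul_I, hre]
    have h3 : (α ^ 2 + β ^ 2) ^ 2 = y ^ 2 + 1 / 4 := by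
      rw [← h1]
      linear_combination (4 * α * β + 1) * h2
    have h4 : (α ^ 2 + v ^ 2) ^ 2 ≤ (α ^ 2 + β ^ 2) ^ 2 := by gcongr
    have h5 : R * y ≤ R * (α ^ 2 - v ^ 2) := by gcongr; linarith
    nlinarith
  have hI1 : ∫ x in (-1 / 2 : ℝ)..(1 / 2), h (y + x * Complex.I) * Complex.I =
      W (y + (1 / 2 : ℝ) * Complex.I) - W (y + (-1 / 2 : ℝ) * Complex.I) := by
    refine intervalIntegral.integral_eq_sub_of_hasDerivAt
      (f := fun x : ℝ => W (y + x * Complex.I)) (fun x hx => ?_) ?_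
    · have hd1 : HasDerivAt (fun x : ℝ => (y + x * Complex.I : ℂ)) Complex.I x := by
        simpa using ((Complex.ofRealCLM.hasDerivAt (x := x)).mul_const Complex.I).const_add (y : ℂ)
      exact (hW _ (hline x hx)).comp x hd1
    · refine ContinuousOn.intervalIntegrable (ContinuousOn.mul ?_ continuousOn_const)
      exact hd.continuousOn.comp (by fun_prop) hline
  have hI2 : ∫ v in -β..β, 2 * besselIntegrand a b (α + v * Complex.I) * Complex.I =
      W ((α + β * Complex.I) ^ 2) - W ((α + (-β : ℝ) * Complex.I) ^ 2) := by
    refine intervalIntegral.integral_eq_sub_of_hasDerivAt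
      (f := fun v : ℝ => W ((α + v * Complex.I) ^ 2)) (fun v hv => ?_) ?_
    · have hd1 : HasDerivAt (fun x : ℝ => (α + x * Complex.I : ℂ)) Complex.I v := by
        simpa using ((Complex.ofRealCLM.hasDerivAt (x := v)).mul_const Complex.I).const_add (α : ℂ)
      have hd2 := (hW _ (hcurve v hv)).comp v (hd1.pow 2)
      refine hd2.congr_deriv ?_
      have hsq : Complex.sqrt ((α + v * Complex.I : ℂ) ^ 2) = α + v * Complex.I := by
        rw [Complex.sqrt]
        exact Complex.sq_cpow_two_inv (by simpa using hα)
      simp only [h_def, hsq, besselIntegrand]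
      push_cast
      ring
    · have := continuous_besselIntegrand a b hα
      exact Continuous.intervalIntegrable (by fun_prop) _ _
  have he1 : (y + (1 / 2 : ℝ) * Complex.I : ℂ) = (α + β * Complex.I) ^ 2 := by
    have h2' : (α * β : ℂ) = 1 / 4 := by
      rw [← Complex.ofReal_mul, h2]
      norm_num
    rw [← h1]
    push_cast
    linear_combination (-β ^ 2 : ℂ) * Complex.I_sq - 2 * Complex.I * h2'
  have he2 : (y + (-1 / 2 : ℝ) * Complex.I : ℂ) = (α + (-β : ℝ) * Complex.I) ^ 2 := by
    have h2' : (α * β : ℂ) = 1 / 4 := by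
      rw [← Complex.ofReal_mul, h2]
      norm_num
    rw [← h1]
    push_cast
    linear_combination (-β ^ 2 : ℂ) * Complex.I_sq + 2 * Complex.I * h2'
  rw [he1, he2, ← hI2, intervalIntegral.integral_mul_const, intervalIntegral.integral_mul_const,
    intervalIntegral.integral_const_mul] at hI1
  exact mul_right_cancel₀ Complex.I_ne_zero hI1

theorem norm_exp_mul_sq (b α v : ℝ) :
    ‖Complex.exp (b * (α + v * Complex.I) ^ 2)‖ = Real.exp (b * (α ^ 2 - v ^ 2)) := by
  rw [Complex.norm_exp]
  simp [sq]

theorem integrable_one_add_sq_mul_exp {b : ℝ} (hb : 0 < b) :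
    MeasureTheory.Integrable fun v : ℝ => (1 + v ^ 2) * Real.exp (-b * v ^ 2) := by
  have h1 := integrable_exp_neg_mul_sq hb
  have h2 := integrable_rpow_mul_exp_neg_mul_sq hb (s := 2) (by norm_num)
  simp only [Real.rpow_two] at h2
  simp only [add_mul, one_mul]
  exact h1.add h2

theorem integrable_mul_exp_mul_sq {b K : ℝ} (hb : 0 < b) (α : ℝ) {g : ℝ → ℂ} (hg : Continuous g)
    (hK : ∀ v, ‖g v‖ ≤ K * (1 + v ^ 2)) :
    MeasureTheory.Integrable fun v : ℝ => g v * Complex.exp (b * (α + v * Complex.I) ^ 2) := by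
  refine ((integrable_one_add_sq_mul_exp hb).const_mul (K * Real.exp (b * α ^ 2))).mono'
    (Continuous.aestronglyMeasurable (by fun_prop)) (Eventually.of_forall fun v => ?_)
  rw [norm_mul, norm_exp_mul_sq]
  calc _ ≤ K * (1 + v ^ 2) * Real.exp (b * (α ^ 2 - v ^ 2)) := by gcongr; exact hK v
    _ = _ := by
      rw [show b * (α ^ 2 - v ^ 2) = b * α ^ 2 + -b * v ^ 2 by ring, Real.exp_add]
      ring

theorem norm_inv_sq_pow_le {α : ℝ} (hα : 0 < α) (v : ℝ) (j : ℕ) :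
    ‖((α + v * Complex.I : ℂ) ^ 2)⁻¹ ^ j‖ ≤ (α ^ 2)⁻¹ ^ j := by
  rw [norm_pow, norm_inv, norm_pow, norm_sq_add_mul_I]
  gcongr
  nlinarith [sq_nonneg v]

theorem norm_le_mul_one_add_sq (α v : ℝ) :
    ‖(α + v * Complex.I : ℂ)‖ ^ 2 ≤ (1 + α ^ 2) * (1 + v ^ 2) := by
  rw [norm_sq_add_mul_I]
  nlinarith [mul_nonneg (sq_nonneg α) (sq_nonneg v)]

/-- The moments `∫ t ^ (2 - 2 * j) * exp (b * t ^ 2)` along the vertical line of abscissa `α`. -/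
noncomputable def gaussianMoment (b α : ℝ) (j : ℕ) : ℂ :=
  ∫ v : ℝ, (α + v * Complex.I : ℂ) ^ 2 * ((α + v * Complex.I : ℂ) ^ 2)⁻¹ ^ j *
    Complex.exp (b * (α + v * Complex.I) ^ 2)

theorem continuous_inv_sq_pow {α : ℝ} (hα : 0 < α) (j : ℕ) :
    Continuous fun v : ℝ => ((α + v * Complex.I : ℂ) ^ 2)⁻¹ ^ j := by
  have h (v : ℝ) : (α + v * Complex.I : ℂ) ^ 2 ≠ 0 := pow_ne_zero 2 (ofReal_add_mul_I_ne_zero hα v)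
  fun_prop (disch := assumption)

theorem norm_sq_mul_inv_sq_pow_le {α : ℝ} (hα : 0 < α) (v : ℝ) (j : ℕ) :
    ‖(α + v * Complex.I : ℂ) ^ 2 * ((α + v * Complex.I : ℂ) ^ 2)⁻¹ ^ j‖ ≤
      (1 + α ^ 2) * (α ^ 2)⁻¹ ^ j * (1 + v ^ 2) := by
  rw [norm_mul, norm_pow]
  have h1 := norm_le_mul_one_add_sq α v
  have h2 := norm_inv_sq_pow_le hα v j
  calc _ ≤ (1 + α ^ 2) * (1 + v ^ 2) * (α ^ 2)⁻¹ ^ j := by gcongr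
    _ = _ := by ring

theorem integrable_gaussianMoment {b α : ℝ} (hb : 0 < b) (hα : 0 < α) (j : ℕ) :
    MeasureTheory.Integrable fun v : ℝ =>
      (α + v * Complex.I : ℂ) ^ 2 * ((α + v * Complex.I : ℂ) ^ 2)⁻¹ ^ j *
        Complex.exp (b * (α + v * Complex.I) ^ 2) := by
  have := continuous_inv_sq_pow hα j
  exact integrable_mul_exp_mul_sq hb α (by fun_prop) fun v => norm_sq_mul_inv_sq_pow_le hα v j

theorem gaussianMoment_succ {b α : ℝ} (hb : 0 < b) (hα : 0 < α) (j : ℕ) :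
    (2 * j - 1) * gaussianMoment b α (j + 1) = 2 * b * gaussianMoment b α j := by
  have hderiv (v : ℝ) : HasDerivAt (fun v : ℝ => (α + v * Complex.I : ℂ) *
      ((α + v * Complex.I : ℂ) ^ 2)⁻¹ ^ j * Complex.exp (b * (α + v * Complex.I) ^ 2))
      (Complex.I * (2 * b * ((α + v * Complex.I : ℂ) ^ 2 * ((α + v * Complex.I : ℂ) ^ 2)⁻¹ ^ j *
        Complex.exp (b * (α + v * Complex.I) ^ 2)) -
      (2 * j - 1) * ((α + v * Complex.I : ℂ) ^ 2 * ((α + v * Complex.I : ℂ) ^ 2)⁻¹ ^ (j + 1) *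
        Complex.exp (b * (α + v * Complex.I) ^ 2)))) v := by
    have ht := ofReal_add_mul_I_ne_zero hα v
    have hd1 : HasDerivAt (fun x : ℝ => (α + x * Complex.I : ℂ)) Complex.I v := by
      simpa using ((Complex.ofRealCLM.hasDerivAt (x := v)).mul_const Complex.I).const_add (α : ℂ)
    have hd := (hd1.mul (((hd1.pow 2).inv (pow_ne_zero 2 ht)).pow j)).mul
      (((hd1.pow 2).const_mul (b : ℂ)).cexp)
    refine hd.congr_deriv ?_
    simp only [Pi.mul_apply, Pi.pow_apply, Pi.inv_apply]
    clear hd hd1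
    generalize (α + v * Complex.I : ℂ) = t at ht ⊢
    rcases j with _ | j
    · simp only [zero_add, pow_one, pow_zero]
      field_simp
      push_cast
      ring
    · simp only [Nat.add_sub_cancel, pow_succ _ j, pow_succ _ (j + 1)]
      field_simp
      push_cast
      ring
  have hi := integrable_gaussianMoment hb hα
  have hintegral : MeasureTheory.Integrable (fun v : ℝ => (α + v * Complex.I : ℂ) *
      ((α + v * Complex.I : ℂ) ^ 2)⁻¹ ^ j * Complex.exp (b * (α + v * Complex.I) ^ 2)) := by
    have := continuous_inv_sq_pow hα j
    refine integrable_mul_exp_mul_sq (K := (1 + (1 + α ^ 2)) * (α ^ 2)⁻¹ ^ j) hb α (by fun_prop)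
      fun v => ?_
    rw [norm_mul]
    have h1 := norm_le_mul_one_add_sq α v
    have h2 := norm_inv_sq_pow_le hα v j
    have h3 : ‖(α + v * Complex.I : ℂ)‖ ≤ (1 + (1 + α ^ 2)) * (1 + v ^ 2) := by
      nlinarith [sq_nonneg (‖(α + v * Complex.I : ℂ)‖ - 1), sq_nonneg v]
    calc _ ≤ (1 + (1 + α ^ 2)) * (1 + v ^ 2) * (α ^ 2)⁻¹ ^ j := by gcongr
      _ = _ := by ring
  have h0 := MeasureTheory.integral_eq_zero_of_hasDerivAt_of_integrable hderiv
    ((((hi j).const_mul _).sub ((hi (j + 1)).const_mul _)).const_mul _) hintegral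
  rw [MeasureTheory.integral_const_mul, MeasureTheory.integral_sub ((hi j).const_mul _)
    ((hi (j + 1)).const_mul _), MeasureTheory.integral_const_mul,
    MeasureTheory.integral_const_mul, mul_eq_zero_iff_left Complex.I_ne_zero] at h0
  exact (sub_eq_zero.mp h0).symm

theorem gaussianMoment_one {b α : ℝ} (hb : 0 < b) (hα : 0 < α) :
    gaussianMoment b α 1 = (Real.sqrt (Real.pi / b) : ℝ) := by
  have h := GaussianFourier.integral_cexp_neg_mul_sq_add_real_mul_I (b := b) (by simpa using hb)
    (-α)
  have h2 (v : ℝ) : (α + v * Complex.I : ℂ) ^ 2 * ((α + v * Complex.I : ℂ) ^ 2)⁻¹ ^ 1 *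
      Complex.exp (b * (α + v * Complex.I) ^ 2) =
      Complex.exp (-b * (v + (-α : ℝ) * Complex.I) ^ 2) := by
    rw [pow_one, mul_inv_cancel₀ (pow_ne_zero 2 (ofReal_add_mul_I_ne_zero hα v)), one_mul]
    congr 1
    push_cast
    linear_combination (b * v ^ 2 + b * α ^ 2 : ℂ) * Complex.I_sq
  rw [gaussianMoment]
  simp_rw [h2]
  rw [h, Real.sqrt_eq_rpow, Complex.ofReal_cpow (by positivity [Real.pi_pos])]
  push_cast
  rfl

theorem gaussianMoment_eq {b α : ℝ} (hb : 0 < b) (hα : 0 < α) (j : ℕ) :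
    gaussianMoment b α j = ((2 * j - 1) * (4 * b) ^ j * j.factorial / (2 * j).factorial *
      (Real.sqrt (Real.pi / b) / (2 * b)) : ℝ) := by
  have hbc : (b : ℂ) ≠ 0 := by exact_mod_cast hb.ne'
  induction j with
  | zero =>
    have h := gaussianMoment_succ hb hα 0
    rw [zero_add, gaussianMoment_one hb hα] at h
    push_cast at h ⊢
    field_simp
    simp
    linear_combination -h
  | succ j ih =>
    have h := gaussianMoment_succ hb hα j
    have hj : (2 * j - 1 : ℂ) ≠ 0 := by
      have : (2 * j - 1 : ℤ) ≠ 0 := by omega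
      exact_mod_cast this
    have hf : ((2 * (j + 1)).factorial : ℝ) = (2 * j + 2) * (2 * j + 1) * (2 * j).factorial := by
      rw [mul_add, mul_one, Nat.factorial_succ, Nat.factorial_succ]
      push_cast
      ring
    rw [hf, Nat.factorial_succ, ← mul_right_inj' hj, h, ih]
    have h1 : (2 * j + 1 : ℂ) ≠ 0 := by exact_mod_cast (by omega : 2 * j + 1 ≠ 0)
    have h2 : (2 * j + 2 : ℂ) ≠ 0 := by exact_mod_cast (by omega : 2 * j + 2 ≠ 0)
    have h3 : ((2 * j).factorial : ℂ) ≠ 0 := by exact_mod_cast Nat.factorial_ne_zero _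
    push_cast
    field_simp
    ring

theorem hasSum_two_mul_sub_one_mul_pow_div (z : ℝ) :
    HasSum (fun j : ℕ => (2 * j - 1) * z ^ (2 * j) / (2 * j).factorial)
      (z * Real.sinh z - Real.cosh z) := by
  have h1 : HasSum (fun j : ℕ => 2 * j * z ^ (2 * j) / (2 * j).factorial) (z * Real.sinh z) := by
    rw [← hasSum_nat_add_iff' 1]
    simp only [Finset.range_one, Finset.sum_singleton, Nat.cast_zero, mul_zero, zero_mul, zero_div,
      sub_zero]
    convert! (Real.hasSum_sinh z).mul_left z using 2 with j
    rw [mul_add, mul_one, Nat.factorial_succ]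
    push_cast
    field_simp
    ring
  convert! h1.sub (Real.hasSum_cosh z) using 2 with j
  ring

theorem integrable_besselIntegrand {a b α : ℝ} (ha : 0 ≤ a) (hb : 0 < b) (hα : 0 < α) :
    MeasureTheory.Integrable fun v : ℝ => besselIntegrand a b (α + v * Complex.I) := by
  have h (v : ℝ) : (α + v * Complex.I : ℂ) ^ 2 ≠ 0 := pow_ne_zero 2 (ofReal_add_mul_I_ne_zero hα v)
  simp only [besselIntegrand, Complex.exp_add, ← mul_assoc]
  refine integrable_mul_exp_mul_sq (K := (1 + α ^ 2) * Real.exp (a * (α ^ 2)⁻¹)) hb α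
    (by fun_prop (disch := assumption)) fun v => ?_
  rw [norm_mul, norm_pow]
  have h1 := norm_le_mul_one_add_sq α v
  have h2 : ‖Complex.exp (a / (α + v * Complex.I) ^ 2)‖ ≤ Real.exp (a * (α ^ 2)⁻¹) := by
    refine (Complex.norm_exp_le_exp_norm _).trans (Real.exp_le_exp.mpr ?_)
    rw [div_eq_mul_inv, norm_mul, Complex.norm_of_nonneg ha]
    gcongr
    simpa using norm_inv_sq_pow_le hα v 1
  calc _ ≤ (1 + α ^ 2) * (1 + v ^ 2) * Real.exp (a * (α ^ 2)⁻¹) := by gcongr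
    _ = _ := by ring

theorem integral_besselIntegrand {a b α : ℝ} (ha : 0 ≤ a) (hb : 0 < b) (hα : 0 < α) :
    ∫ v : ℝ, besselIntegrand a b (α + v * Complex.I) =
      ((2 * √(a * b) * Real.sinh (2 * √(a * b)) - Real.cosh (2 * √(a * b))) *
        (√(Real.pi / b) / (2 * b)) : ℝ) := by
  have hintegral := integrable_gaussianMoment hb hα
  set F : ℕ → ℝ → ℂ := fun j v => (a ^ j / j.factorial : ℂ) * ((α + v * Complex.I : ℂ) ^ 2 *
    ((α + v * Complex.I : ℂ) ^ 2)⁻¹ ^ j * Complex.exp (b * (α + v * Complex.I) ^ 2)) with hF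
  have hF_int (j : ℕ) : MeasureTheory.Integrable (F j) := (hintegral j).const_mul _
  have hbase := (integrable_one_add_sq_mul_exp hb).const_mul ((1 + α ^ 2) * Real.exp (b * α ^ 2))
  have hF_norm (j : ℕ) : ∫ v, ‖F j v‖ ≤ (a * (α ^ 2)⁻¹) ^ j / j.factorial *
      ∫ v : ℝ, (1 + α ^ 2) * Real.exp (b * α ^ 2) * ((1 + v ^ 2) * Real.exp (-b * v ^ 2)) := by
    rw [← MeasureTheory.integral_const_mul]
    refine MeasureTheory.integral_mono (hF_int j).norm (hbase.const_mul _) fun v => ?_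
    simp only [hF]
    rw [norm_mul, norm_mul _ (Complex.exp _), norm_exp_mul_sq]
    have h1 : ‖(a ^ j / j.factorial : ℂ)‖ = a ^ j / j.factorial := by
      rw [norm_div, norm_pow, Complex.norm_of_nonneg ha]
      simp
    have h2 := norm_sq_mul_inv_sq_pow_le hα v j
    calc _ ≤ a ^ j / j.factorial * ((1 + α ^ 2) * (α ^ 2)⁻¹ ^ j * (1 + v ^ 2) *
          Real.exp (b * (α ^ 2 - v ^ 2))) := by rw [h1]; gcongr
      _ = _ := by
        rw [show b * (α ^ 2 - v ^ 2) = b * α ^ 2 + -b * v ^ 2 by ring, Real.exp_add]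
        ring
  have hF_sum : Summable fun j => ∫ v, ‖F j v‖ :=
    Summable.of_nonneg_of_le (fun j => MeasureTheory.integral_nonneg fun v => norm_nonneg _) hF_norm
      ((Real.summable_pow_div_factorial _).mul_right _)
  have key := MeasureTheory.hasSum_integral_of_summable_integral_norm hF_int hF_sum
  have htsum (v : ℝ) : ∑' j, F j v = besselIntegrand a b (α + v * Complex.I) := by
    have h1 : HasSum (fun j : ℕ => (a / (α + v * Complex.I) ^ 2 : ℂ) ^ j / j.factorial)
        (Complex.exp (a / (α + v * Complex.I) ^ 2)) := by
      rw [Complex.exp_eq_exp_ℂ]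
      exact NormedSpace.expSeries_div_hasSum_exp _
    rw [besselIntegrand, Complex.exp_add, mul_left_comm, ← h1.tsum_eq, ← tsum_mul_right]
    refine tsum_congr fun j => ?_
    simp only [hF]
    rw [div_pow, inv_pow]
    ring
  simp_rw [htsum] at key
  have hterm (j : ℕ) : ∫ v, F j v = (((2 * j - 1) * (2 * √(a * b)) ^ (2 * j) / (2 * j).factorial *
      (√(Real.pi / b) / (2 * b)) : ℝ) : ℂ) := by
    simp only [hF]
    rw [MeasureTheory.integral_const_mul, ← gaussianMoment, gaussianMoment_eq hb hα, pow_mul,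
      mul_pow 2 √(a * b), Real.sq_sqrt (by positivity)]
    have h3 : (j.factorial : ℂ) ≠ 0 := by exact_mod_cast Nat.factorial_ne_zero _
    push_cast
    rw [mul_pow, mul_pow, mul_pow]
    field_simp
    norm_num
    ring
  simp_rw [hterm] at key
  refine key.unique (Complex.hasSum_ofReal.mpr ?_)
  exact (hasSum_two_mul_sub_one_mul_pow_div _).mul_right _

theorem norm_integral_besselIntegrand_sub_le {a b α β y : ℝ} (ha : 0 ≤ a) (hb : 1 ≤ b)
    (hy : 0 < y) (hα : 0 < α) (hα1 : α ≤ 1) (hβ : 0 < β) (h1 : α ^ 2 - β ^ 2 = y)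
    (h2 : α * β = 1 / 4) :
    ‖(∫ v : ℝ, besselIntegrand a b (α + v * Complex.I)) -
      ∫ v in -β..β, besselIntegrand a b (α + v * Complex.I)‖ ≤
    Real.exp (1 / 4 + 4 * a) * (2 * ∫ v : ℝ, (1 + v ^ 2) * Real.exp (-1 * v ^ 2)) *
      Real.exp (b * y) := by
  have hintegral := integrable_besselIntegrand ha (one_pos.trans_le hb) hα
  have hg := (integrable_one_add_sq_mul_exp one_pos).const_mul
    (Real.exp (1 / 4 + 4 * a) * 2 * Real.exp (b * y))
  have hβα : β ≤ α := by nlinarith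
  have hα4 : 1 / 4 ≤ α ^ 2 := by nlinarith
  have hβ4 : β ^ 2 ≤ 1 / 4 := by nlinarith
  rw [intervalIntegral.integral_of_le (by linarith),
    ← MeasureTheory.integral_add_compl measurableSet_Ioc hintegral, add_sub_cancel_left]
  calc _ ≤ ∫ v in (Set.Ioc (-β) β)ᶜ, Real.exp (1 / 4 + 4 * a) * 2 * Real.exp (b * y) *
        ((1 + v ^ 2) * Real.exp (-1 * v ^ 2)) := by
        refine MeasureTheory.norm_integral_le_of_norm_le hg.restrict ?_
        refine (MeasureTheory.ae_restrict_iff' measurableSet_Ioc.compl).mpr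
          (Eventually.of_forall fun v hv => ?_)
        have hv2 : β ^ 2 ≤ v ^ 2 := by
          rw [Set.mem_compl_iff, Set.mem_Ioc, not_and_or, not_lt, not_le] at hv
          rcases hv with hv | hv <;> nlinarith
        rw [besselIntegrand, Complex.exp_add, norm_mul, norm_mul, norm_exp_mul_sq, norm_pow,
          norm_sq_add_mul_I]
        have h3 : ‖Complex.exp (a / (α + v * Complex.I) ^ 2)‖ ≤ Real.exp (4 * a) := by
          refine (Complex.norm_exp_le_exp_norm _).trans (Real.exp_le_exp.mpr ?_)
          rw [norm_div, norm_pow, norm_sq_add_mul_I, Complex.norm_of_nonneg ha,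
            div_le_iff₀ (by positivity)]
          nlinarith [mul_nonneg ha (sq_nonneg v), mul_nonneg ha (sub_nonneg.mpr hα4)]
        have h4 : Real.exp (b * (α ^ 2 - v ^ 2)) ≤
            Real.exp (1 / 4) * Real.exp (b * y) * Real.exp (-1 * v ^ 2) := by
          rw [← Real.exp_add, ← Real.exp_add, Real.exp_le_exp, ← h1]
          nlinarith
        have h5 : α ^ 2 + v ^ 2 ≤ 2 * (1 + v ^ 2) := by nlinarith [sq_nonneg v]
        calc _ ≤ 2 * (1 + v ^ 2) * (Real.exp (4 * a) *
              (Real.exp (1 / 4) * Real.exp (b * y) * Real.exp (-1 * v ^ 2))) := by gcongr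
          _ = _ := by rw [Real.exp_add]; ring
    _ ≤ ∫ v : ℝ, Real.exp (1 / 4 + 4 * a) * 2 * Real.exp (b * y) *
        ((1 + v ^ 2) * Real.exp (-1 * v ^ 2)) :=
      MeasureTheory.setIntegral_le_integral hg (Eventually.of_forall fun v => by positivity)
    _ = _ := by
      rw [MeasureTheory.integral_const_mul]
      ring

theorem exists_sq_sub_sq_eq {y : ℝ} (hy : 0 < y) (hy1 : y ≤ 1 / 16) :
    ∃ α β : ℝ, 0 < α ∧ α ≤ 1 ∧ 0 < β ∧ α ^ 2 - β ^ 2 = y ∧ α * β = 1 / 4 := by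
  have hr := Real.sq_sqrt (show 0 ≤ y ^ 2 + 1 / 4 by positivity)
  have hr0 : 0 < √(y ^ 2 + 1 / 4) := Real.sqrt_pos.mpr (by positivity)
  set r := √(y ^ 2 + 1 / 4)
  have hα := Real.sq_sqrt (show 0 ≤ (y + r) / 2 by positivity)
  have hα0 : 0 < √((y + r) / 2) := Real.sqrt_pos.mpr (by positivity)
  set α := √((y + r) / 2)
  refine ⟨α, 1 / (4 * α), hα0, ?_, by positivity, ?_, by field_simp⟩
  · have hr1 : r ≤ 1 := by nlinarith
    rw [← sq_le_one_iff₀ hα0.le, hα]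
    linarith
  · rw [div_pow, mul_pow, hα]
    field_simp
    nlinarith

/-- The real main term for `partitionFn n`, as a function of `μ = muP n`. -/
noncomputable def partitionMain (μ : ℝ) : ℝ :=
  √12 * Real.pi ^ 2 / (18 * μ ^ 3) * (μ * Real.sinh μ - Real.cosh μ)

theorem exists_abs_partitionFn_sub_main_le :
    ∃ C : ℝ, 0 ≤ C ∧ ∀ n : ℕ, 11 ≤ n →
      |(partitionFn n : ℝ) - partitionMain (muP n)| ≤ C * Real.exp (9 / 10 * muP n) := by
  have hpi := Real.pi_pos
  have hpi3 := Real.pi_gt_three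
  have hpi4 := Real.pi_lt_d2
  obtain ⟨C, hC0, hC⟩ := exists_norm_partitionFn_sub_integral_le
  set D := Real.exp (1 / 4 + 4 * (Real.pi / 12)) *
    (2 * ∫ v : ℝ, (1 + v ^ 2) * Real.exp (-1 * v ^ 2)) with hD
  have hD0 : 0 ≤ D := by
    have : 0 ≤ ∫ v : ℝ, (1 + v ^ 2) * Real.exp (-1 * v ^ 2) :=
      MeasureTheory.integral_nonneg fun v => by positivity
    positivity
  refine ⟨C * Real.exp 1 + 2 * D, by positivity, fun n hn => ?_⟩
  have hn' : (11 : ℝ) ≤ n := by exact_mod_cast hn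
  have hw2 : √(24 * (n : ℝ) - 1) ^ 2 = 24 * n - 1 := Real.sq_sqrt (by linarith)
  have hw16 : 16 ≤ √(24 * (n : ℝ) - 1) := Real.le_sqrt_of_sq_le (by linarith)
  have hμ : muP n = Real.pi * √(24 * (n : ℝ) - 1) / 6 := rfl
  set w := √(24 * (n : ℝ) - 1)
  have hw : 0 < w := by linarith
  set b := Real.pi * w ^ 2 / 12 with hb
  set y := 1 / w with hy
  have hy0 : 0 < y := by positivity
  have hy16 : y ≤ 1 / 16 := one_div_le_one_div_of_le (by norm_num) hw16
  have hb0 : 0 < b := by positivity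
  have hb1 : 1 ≤ b := by rw [hb]; nlinarith
  obtain ⟨α, β, hα0, hα1, hβ0, h1, h2⟩ := exists_sq_sub_sq_eq hy0 hy16
  have hintegral : ∫ x in (-1 / 2 : ℝ)..(1 / 2), partitionGFMain (y + x * Complex.I) *
      Complex.exp ((2 * Real.pi * n : ℝ) * (y + x * Complex.I)) =
      2 * ∫ v in -β..β, besselIntegrand (Real.pi / 12) b (α + v * Complex.I) := by
    rw [← integral_sqrt_mul_exp_eq hy0 hα0 hβ0 h1 h2]
    refine intervalIntegral.integral_congr fun x _ => ?_
    simp only [partitionGFMain]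
    rw [mul_comm (Complex.exp _) (Complex.sqrt _), mul_assoc, mul_assoc, ← Complex.exp_add,
      ← Complex.exp_add]
    congr 2
    rw [hb, hw2]
    push_cast
    ring
  have hab : 2 * √(Real.pi / 12 * b) = muP n := by
    rw [hb, show Real.pi / 12 * (Real.pi * w ^ 2 / 12) = (Real.pi * w / 12) ^ 2 by ring,
      Real.sqrt_sq (by positivity), hμ]
    ring
  have hmain : 2 * ((∫ v : ℝ, besselIntegrand (Real.pi / 12) b (α + v * Complex.I))) =
      (partitionMain (muP n) : ℂ) := by
    rw [integral_besselIntegrand (by positivity) hb0 hα0, hab]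
    have hsq : √(Real.pi / b) = √12 / w := by
      rw [hb, show Real.pi / (Real.pi * w ^ 2 / 12) = 12 / w ^ 2 by field_simp,
        Real.sqrt_div (by norm_num), Real.sqrt_sq hw.le]
    have hcoef : 2 * (√(Real.pi / b) / (2 * b)) = √12 * Real.pi ^ 2 / (18 * muP n ^ 3) := by
      rw [hsq, hb, hμ]
      field_simp
      norm_num
    rw [partitionMain, ← hcoef]
    push_cast
    ring
  have htail := norm_integral_besselIntegrand_sub_le (a := Real.pi / 12) (by positivity) hb1 hy0
    hα0 hα1 hβ0 h1 h2
  rw [← hD] at htail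
  have herr := hC n y hy0 hy16
  rw [hintegral] at herr
  have he1 : Real.exp (Real.pi / 12 / y - 1 / (4 * Real.pi * y) + 2 * Real.pi * n * y) ≤
      Real.exp 1 * Real.exp (9 / 10 * muP n) := by
    rw [← Real.exp_add, Real.exp_le_exp, hμ]
    have h3 : 2 * Real.pi * n * y = Real.pi * w / 12 + Real.pi / 12 * y := by
      rw [hy]
      field_simp
      linear_combination (-1 : ℝ) * hw2
    have h4 : Real.pi / 12 / y = Real.pi * w / 12 := by rw [hy]; field_simp
    have h5 : Real.pi / 60 * w ≤ 1 / (4 * Real.pi * y) := by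
      rw [hy, le_div_iff₀ (by positivity)]
      field_simp
      nlinarith
    rw [h3, h4]
    nlinarith
  have he2 : Real.exp (b * y) ≤ Real.exp (9 / 10 * muP n) := by
    rw [Real.exp_le_exp, hb, hμ, hy]
    field_simp
    norm_num
  rw [← Real.norm_eq_abs, ← Complex.norm_real, Complex.ofReal_sub, ← hmain, Complex.ofReal_natCast]
  calc _ = ‖((partitionFn n : ℂ) -
        2 * ∫ v in -β..β, besselIntegrand (Real.pi / 12) b (α + v * Complex.I)) -
        2 * ((∫ v : ℝ, besselIntegrand (Real.pi / 12) b (α + v * Complex.I)) -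
        ∫ v in -β..β, besselIntegrand (Real.pi / 12) b (α + v * Complex.I))‖ := by
        congr 1
        ring
    _ ≤ C * (Real.exp 1 * Real.exp (9 / 10 * muP n)) + 2 * (D * Real.exp (9 / 10 * muP n)) := by
        refine (norm_sub_le _ _).trans (add_le_add (herr.trans (by gcongr)) ?_)
        rw [norm_mul, Complex.norm_two]
        gcongr
        exact htail.trans (by gcongr)
    _ = _ := by ring

theorem abs_partitionMain_sub_le {μ : ℝ} (hμ : 1 ≤ μ) :
    |partitionMain μ - √12 * Real.pi ^ 2 * Real.exp μ / (36 * μ ^ 2) * (1 - 1 / μ)| ≤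
      √12 * Real.pi ^ 2 / 18 * Real.exp (9 / 10 * μ) := by
  have hμ0 : 0 < μ := by linarith
  have h1 : partitionMain μ - √12 * Real.pi ^ 2 * Real.exp μ / (36 * μ ^ 2) * (1 - 1 / μ) =
      -(√12 * Real.pi ^ 2 / 18 * ((μ + 1) / (2 * μ ^ 3) * Real.exp (-μ))) := by
    rw [partitionMain, Real.sinh_eq, Real.cosh_eq]
    field_simp
    ring
  rw [h1, abs_neg, abs_of_nonneg (by positivity)]
  gcongr
  calc _ ≤ 1 * Real.exp (-μ) := by
        gcongr
        rw [div_le_one (by positivity)]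
        have : 1 ≤ μ ^ 2 := one_le_pow₀ hμ
        nlinarith
    _ ≤ _ := by
        rw [one_mul, Real.exp_le_exp]
        linarith

theorem tendsto_muP_atTop : Tendsto muP atTop atTop := by
  have h1 : Tendsto (fun n : ℕ => 24 * (n : ℝ) - 1) atTop atTop :=
    tendsto_atTop_add_const_right _ _
      (tendsto_natCast_atTop_atTop.const_mul_atTop (by norm_num))
  exact ((Real.tendsto_sqrt_atTop.comp h1).const_mul_atTop Real.pi_pos).atTop_div_const
    (by norm_num)

theorem partition_bounds (l : ℕ) (hl : 0 < l) :
    ∃ N : ℕ, 0 < N ∧ ∀ n : ℕ, N ≤ n →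
      Real.sqrt 12 * Real.pi ^ 2 * Real.exp (muP n) / (36 * (muP n) ^ 2) *
          (1 - 1 / muP n - 1 / (muP n) ^ l) < (partitionFn n : ℝ) ∧
      (partitionFn n : ℝ) <
        Real.sqrt 12 * Real.pi ^ 2 * Real.exp (muP n) / (36 * (muP n) ^ 2) *
          (1 - 1 / muP n + 1 / (muP n) ^ l) := by
  obtain ⟨C, hC0, hC⟩ := exists_abs_partitionFn_sub_main_le
  have hpi := Real.pi_pos
  set A := √12 * Real.pi ^ 2 / 36 with hA
  have hA0 : 0 < A := by positivity
  set K := C + 2 * A with hK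
  have hK0 : 0 < K := by positivity
  have hlim : ∀ᶠ μ : ℝ in atTop, μ ^ (l + 2) ≤ A / (2 * K) * Real.exp (1 / 10 * μ) := by
    filter_upwards [(isLittleO_pow_exp_pos_mul_atTop (l + 2) (b := 1 / 10)
      (by norm_num)).bound (show 0 < A / (2 * K) by positivity)] with μ h
    rw [Real.norm_eq_abs, Real.norm_eq_abs, Real.abs_exp] at h
    exact (le_abs_self _).trans h
  obtain ⟨N, hN⟩ := eventually_atTop.mp
    (tendsto_muP_atTop.eventually (hlim.and (eventually_ge_atTop 1)))
  refine ⟨max N 11, by positivity, fun n hn => ?_⟩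
  obtain ⟨h1, h2⟩ := hN n ((le_max_left _ _).trans hn)
  have h3 := hC n ((le_max_right _ _).trans hn)
  have h4 := abs_partitionMain_sub_le h2
  set μ := muP n
  have hμ0 : 0 < μ := by linarith
  set T := √12 * Real.pi ^ 2 * Real.exp μ / (36 * μ ^ 2) with hT
  have h5 : |(partitionFn n : ℝ) - T * (1 - 1 / μ)| ≤ K * Real.exp (9 / 10 * μ) := by
    refine (abs_sub_le _ (partitionMain μ) _).trans ((add_le_add h3 h4).trans_eq ?_)
    rw [hK, hA]
    ring
  have h6 : K * Real.exp (9 / 10 * μ) < T * (1 / μ ^ l) := by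
    have hT' : T * (1 / μ ^ l) =
        A * (Real.exp (1 / 10 * μ) * Real.exp (9 / 10 * μ)) / μ ^ (l + 2) := by
      rw [← Real.exp_add, ← add_mul, hT, hA, pow_add]
      norm_num
      field_simp
    rw [hT', lt_div_iff₀ (by positivity)]
    calc _ ≤ K * Real.exp (9 / 10 * μ) * (A / (2 * K) * Real.exp (1 / 10 * μ)) := by gcongr
      _ = A * (Real.exp (1 / 10 * μ) * Real.exp (9 / 10 * μ)) / 2 := by field_simp
      _ < _ := half_lt_self (by positivity)
  have h7 := abs_lt.mp (h5.trans_lt h6)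
  constructor
  · rw [mul_sub]
    linarith [h7.1]
  · rw [mul_add]
    linarith [h7.2]
end

section
/- For every positive integer t there exists a positive integer N such that for all integers n ≥ N, (π²·e^{\bar{μ}(n)}/(8·\bar{μ}(n)²))·(1 − 1/\bar{μ}(n) − 1/\bar{μ}(n)^t) < \bar{p}(n) < (π²·e^{\bar{μ}(n)}/(8·\bar{μ}(n)²))·(1 − 1/\bar{μ}(n) + 1/\bar{μ}(n)^t). -/
/-- The overpartition function: `Σ_{λ ⊢ n} 2^{d(λ)}` where `d(λ)` is the number of
distinct part sizes of the partition `λ`. -/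
def overpartitionFn (n : ℕ) : ℕ :=
  ∑ μ : Nat.Partition n, 2 ^ μ.parts.toFinset.card

/-- `μ̄(n) = π √n`. -/
noncomputable def muPbar (n : ℕ) : ℝ := Real.pi * Real.sqrt (n : ℝ)

section

open Filter Topology Finset

/-- The factor `1 + 2 X^(k+1) + 2 X^(2(k+1)) + ⋯` of the overpartition generating function. -/
def overpartitionFactor (k : ℕ) : PowerSeries ℕ :=
  PowerSeries.mk fun n ↦ if n = 0 then 1 else if (k + 1) ∣ n then 2 else 0

/-- The finite product `∏_{k ≤ N} (1 + q^k) / (1 - q^k)`. -/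
noncomputable def overpartitionProd (N : ℕ) (q : ℂ) : ℂ :=
  ∏ k ∈ range N, (1 + q ^ (k + 1)) / (1 - q ^ (k + 1))

/-- The generating function of overpartitions, as a function on the unit disc. -/
noncomputable def overpartitionGen (q : ℂ) : ℂ := ∑' n, (overpartitionFn n : ℂ) * q ^ n

open scoped PowerSeries.WithPiTopology in
theorem overpartitionFactor_eq (k : ℕ) :
    overpartitionFactor k =
      1 + ∑' j : ℕ, PowerSeries.C (2 : ℕ) * (PowerSeries.X : PowerSeries ℕ) ^ ((k + 1) * (j + 1)) := by
  have hs := Nat.Partition.summable_genFun_term (R := ℕ) (fun _ _ ↦ 2) k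
  simp only [PowerSeries.smul_eq_C_mul] at hs
  ext n
  rw [map_add, hs.map_tsum _ (PowerSeries.WithPiTopology.continuous_coeff _ _)]
  simp only [overpartitionFactor, PowerSeries.coeff_mk, PowerSeries.coeff_one, PowerSeries.coeff_C_mul,
    PowerSeries.coeff_X_pow, mul_ite, mul_one, mul_zero]
  rcases Nat.eq_zero_or_pos n with rfl | hn
  · simp
  · rw [if_neg hn.ne', if_neg hn.ne', zero_add]
    split_ifs with h
    · obtain ⟨c, rfl⟩ := h
      have hc : 0 < c := Nat.pos_of_mul_pos_left hn
      rw [tsum_eq_single (c - 1)]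
      · rw [Nat.sub_add_cancel hc, if_pos rfl]
      · intro b hb
        rw [if_neg]
        intro h
        have := Nat.eq_of_mul_eq_mul_left (Nat.succ_pos k) h
        omega
    · rw [tsum_eq_single 0]
      · rw [if_neg]
        rintro rfl
        simp at h
      · intro b _
        rw [if_neg]
        rintro rfl
        simp at h

theorem coeff_genFun_two (n : ℕ) :
    (Nat.Partition.genFun fun _ _ ↦ 2 : PowerSeries ℕ).coeff n = overpartitionFn n := by
  simp [overpartitionFn, Finsupp.prod]

open scoped PowerSeries.WithPiTopology in
theorem eventually_coeff_prod_overpartitionFactor (n : ℕ) :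
    ∀ᶠ N in atTop,
      (∏ k ∈ range N, overpartitionFactor k).coeff n = overpartitionFn n := by
  have h := (Nat.Partition.hasProd_genFun (R := ℕ) (fun _ _ ↦ 2)).tendsto_prod_nat
  rw [PowerSeries.WithPiTopology.tendsto_iff_coeff_tendsto] at h
  have h2 := h n
  rw [coeff_genFun_two, nhds_discrete, tendsto_pure] at h2
  simpa only [overpartitionFactor_eq, PowerSeries.smul_eq_C_mul] using h2

theorem monotone_coeff_prod_overpartitionFactor (n : ℕ) :
    Monotone fun N ↦ (∏ k ∈ range N, overpartitionFactor k).coeff n := by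
  refine monotone_nat_of_le_succ fun N ↦ ?_
  rw [prod_range_succ, PowerSeries.coeff_mul]
  refine le_trans ?_ (single_le_sum (f := fun p : ℕ × ℕ ↦
    (∏ k ∈ range N, overpartitionFactor k).coeff p.1 * (overpartitionFactor N).coeff p.2)
    (fun _ _ ↦ Nat.zero_le _) (a := (n, 0)) (by simp))
  simp [overpartitionFactor]

theorem coeff_prod_overpartitionFactor_le (N n : ℕ) :
    (∏ k ∈ range N, overpartitionFactor k).coeff n ≤ overpartitionFn n := by
  obtain ⟨M, h1, h2⟩ :=
    ((eventually_coeff_prod_overpartitionFactor n).and (eventually_ge_atTop N)).exists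
  rw [← h1]
  exact monotone_coeff_prod_overpartitionFactor n h2

theorem one_sub_pow_ne_zero {q : ℂ} (hq : ‖q‖ < 1) (k : ℕ) : 1 - q ^ (k + 1) ≠ 0 := by
  intro h
  have h2 : ‖q ^ (k + 1)‖ = 1 := by rw [← sub_eq_zero.mp h, norm_one]
  rw [norm_pow] at h2
  exact (pow_lt_one₀ (norm_nonneg q) hq (Nat.succ_ne_zero k)).ne h2

theorem one_add_pow_ne_zero {q : ℂ} (hq : ‖q‖ < 1) (k : ℕ) : 1 + q ^ (k + 1) ≠ 0 := by
  intro h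
  have h2 : ‖q ^ (k + 1)‖ = 1 := by rw [← neg_eq_of_add_eq_zero_right h, norm_neg, norm_one]
  rw [norm_pow] at h2
  exact (pow_lt_one₀ (norm_nonneg q) hq (Nat.succ_ne_zero k)).ne h2

theorem hasSum_overpartitionFactor {q : ℂ} (hq : ‖q‖ < 1) (k : ℕ) :
    (Summable fun n ↦ ‖((overpartitionFactor k).coeff n : ℂ) * q ^ n‖) ∧
      HasSum (fun n ↦ ((overpartitionFactor k).coeff n : ℂ) * q ^ n)
        ((1 + q ^ (k + 1)) / (1 - q ^ (k + 1))) := by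
  have hs : Summable fun n ↦ ‖((overpartitionFactor k).coeff n : ℂ) * q ^ n‖ := by
    refine Summable.of_nonneg_of_le (fun _ ↦ norm_nonneg _) (fun n ↦ ?_)
      ((summable_geometric_of_lt_one (norm_nonneg q) hq).mul_left 2)
    rw [norm_mul, norm_pow]
    gcongr
    simp only [overpartitionFactor, PowerSeries.coeff_mk]
    split_ifs <;> norm_num
  refine ⟨hs, ?_⟩
  have hk : ‖q ^ (k + 1)‖ < 1 := by
    rw [norm_pow]; exact pow_lt_one₀ (norm_nonneg q) hq (Nat.succ_ne_zero k)
  have h1 : HasSum (fun j : ℕ ↦ ((overpartitionFactor k).coeff ((k + 1) * j) : ℂ) *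
      q ^ ((k + 1) * j)) ((1 + q ^ (k + 1)) / (1 - q ^ (k + 1))) := by
    have hg := ((hasSum_geometric_of_norm_lt_one hk).mul_left 2).sub
      (hasSum_ite_eq (0 : ℕ) (1 : ℂ))
    have hv : (1 + q ^ (k + 1)) / (1 - q ^ (k + 1)) = 2 * (1 - q ^ (k + 1))⁻¹ - 1 := by
      have := one_sub_pow_ne_zero hq k
      field_simp
      ring
    rw [hv]
    have hf : ∀ j : ℕ, ((overpartitionFactor k).coeff ((k + 1) * j) : ℂ) * q ^ ((k + 1) * j) =
        2 * (q ^ (k + 1)) ^ j - if j = 0 then 1 else 0 := by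
      intro j
      rcases Nat.eq_zero_or_pos j with rfl | hj
      · simp [overpartitionFactor]; norm_num
      · simp [overpartitionFactor, hj.ne', pow_mul]
    simpa only [hf] using hg
  have hinj : Function.Injective fun j : ℕ ↦ (k + 1) * j :=
    fun a b h ↦ Nat.eq_of_mul_eq_mul_left (Nat.succ_pos k) h
  refine (hinj.hasSum_iff (f := fun n ↦ ((overpartitionFactor k).coeff n : ℂ) * q ^ n) ?_).mp h1
  intro n hn
  have : ¬ (k + 1) ∣ n := fun ⟨c, hc⟩ ↦ hn ⟨c, hc.symm⟩
  have h0 : n ≠ 0 := by rintro rfl; simp at this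
  simp [overpartitionFactor, this, h0]

theorem hasSum_prod_overpartitionFactor {q : ℂ} (hq : ‖q‖ < 1) (N : ℕ) :
    (Summable fun n ↦ ‖((∏ k ∈ range N, overpartitionFactor k).coeff n : ℂ) * q ^ n‖) ∧
      HasSum (fun n ↦ ((∏ k ∈ range N, overpartitionFactor k).coeff n : ℂ) * q ^ n)
        (overpartitionProd N q) := by
  induction N with
  | zero =>
    have h : (fun n ↦ ((∏ k ∈ range 0, overpartitionFactor k).coeff n : ℂ) * q ^ n) =
        fun n ↦ if n = 0 then 1 else 0 := by
      ext n
      rcases Nat.eq_zero_or_pos n with rfl | hn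
      · simp
      · simp [PowerSeries.coeff_one, hn.ne']
    refine ⟨?_, ?_⟩
    · refine summable_of_ne_finset_zero (s := {0}) fun n hn ↦ ?_
      rw [congrFun h n]
      simp at hn
      simp [hn]
    · rw [h]
      simpa [overpartitionProd] using hasSum_ite_eq (0 : ℕ) (1 : ℂ)
  | succ N ih =>
    obtain ⟨f1, f2⟩ := hasSum_overpartitionFactor hq N
    have he : (fun n ↦ ((∏ k ∈ range (N + 1), overpartitionFactor k).coeff n : ℂ) * q ^ n) =
        fun n ↦ ∑ kl ∈ antidiagonal n,
          (((∏ k ∈ range N, overpartitionFactor k).coeff kl.1 : ℂ) * q ^ kl.1) *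
            (((overpartitionFactor N).coeff kl.2 : ℂ) * q ^ kl.2) := by
      ext n
      rw [prod_range_succ, PowerSeries.coeff_mul]
      push_cast
      rw [sum_mul]
      refine sum_congr rfl fun kl hkl ↦ ?_
      rw [← mem_antidiagonal.mp hkl, pow_add]
      ring
    have hsn := summable_norm_sum_mul_antidiagonal_of_summable_norm ih.1 f1
    have ht := tsum_mul_tsum_eq_tsum_sum_antidiagonal_of_summable_norm ih.1 f1
    rw [ih.2.tsum_eq, f2.tsum_eq] at ht
    refine ⟨?_, ?_⟩
    · simpa only [congrFun he] using hsn
    · rw [he, overpartitionProd, prod_range_succ, ← overpartitionProd, ht]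
      exact hsn.of_norm.hasSum

theorem prod_one_add_div_one_sub_le {r : ℝ} (h0 : 0 ≤ r) (h1 : r < 1) (N : ℕ) :
    ∏ k ∈ range N, (1 + r ^ (k + 1)) / (1 - r ^ (k + 1)) ≤ Real.exp (2 / (1 - r) * (1 - r)⁻¹) := by
  have hr : 0 < 1 - r := by linarith
  calc ∏ k ∈ range N, (1 + r ^ (k + 1)) / (1 - r ^ (k + 1))
      ≤ ∏ k ∈ range N, Real.exp (2 / (1 - r) * r ^ k) := by
        refine prod_le_prod (fun k _ ↦ ?_) fun k _ ↦ ?_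
        · have : r ^ (k + 1) ≤ 1 := pow_le_one₀ h0 h1.le
          have : 0 ≤ r ^ (k + 1) := by positivity
          apply div_nonneg <;> linarith
        · have hk : r ^ (k + 1) ≤ r := by
            rw [pow_succ]
            exact mul_le_of_le_one_left h0 (pow_le_one₀ h0 h1.le)
          have hk' : r ^ (k + 1) ≤ r ^ k := pow_le_pow_of_le_one h0 h1.le (Nat.le_succ k)
          have hk0 : 0 ≤ r ^ (k + 1) := by positivity
          have : (1 + r ^ (k + 1)) / (1 - r ^ (k + 1)) =
              2 * r ^ (k + 1) / (1 - r ^ (k + 1)) + 1 := by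
            have : 1 - r ^ (k + 1) ≠ 0 := by linarith
            field_simp
            ring
          rw [this]
          refine le_trans ?_ (Real.add_one_le_exp _)
          have : 2 * r ^ (k + 1) / (1 - r ^ (k + 1)) ≤ 2 * r ^ k / (1 - r) := by gcongr
          have h' : 2 / (1 - r) * r ^ k = 2 * r ^ k / (1 - r) := by ring
          linarith
    _ = Real.exp (2 / (1 - r) * ∑ k ∈ range N, r ^ k) := by rw [← Real.exp_sum, mul_sum]
    _ ≤ _ := by
        gcongr
        rw [← tsum_geometric_of_lt_one h0 h1]
        exact (summable_geometric_of_lt_one h0 h1).sum_le_tsum _ fun _ _ ↦ by positivity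

theorem overpartitionProd_ofReal (N : ℕ) (r : ℝ) :
    overpartitionProd N (r : ℂ) =
      ((∏ k ∈ range N, (1 + r ^ (k + 1)) / (1 - r ^ (k + 1)) : ℝ) : ℂ) := by
  simp [overpartitionProd]

theorem summable_overpartitionFn_mul_pow {r : ℝ} (h0 : 0 ≤ r) (h1 : r < 1) :
    Summable fun n ↦ (overpartitionFn n : ℝ) * r ^ n := by
  refine summable_of_sum_range_le (c := Real.exp (2 / (1 - r) * (1 - r)⁻¹))
    (fun n ↦ by positivity) fun M ↦ ?_
  have hev : ∀ᶠ N in atTop, ∀ n ∈ range M,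
      (∏ k ∈ range N, overpartitionFactor k).coeff n = overpartitionFn n :=
    (eventually_all_finset _).mpr fun n _ ↦ eventually_coeff_prod_overpartitionFactor n
  obtain ⟨N, hN⟩ := hev.exists
  have hq : ‖(r : ℂ)‖ < 1 := by simpa [abs_of_nonneg h0] using h1
  have hs := (hasSum_prod_overpartitionFactor hq N).2
  rw [overpartitionProd_ofReal] at hs
  have hs' : HasSum (fun n ↦ ((∏ k ∈ range N, overpartitionFactor k).coeff n : ℝ) * r ^ n)
      (∏ k ∈ range N, (1 + r ^ (k + 1)) / (1 - r ^ (k + 1))) := by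
    rw [← Complex.hasSum_ofReal]
    simpa using hs
  refine le_trans ?_ (prod_one_add_div_one_sub_le h0 h1 N)
  rw [sum_congr rfl fun n hn ↦ by rw [← hN n hn]]
  exact sum_le_hasSum _ (fun _ _ ↦ by positivity) hs'

theorem tendsto_overpartitionProd {q : ℂ} (hq : ‖q‖ < 1) :
    Tendsto (fun N ↦ overpartitionProd N q) atTop (𝓝 (overpartitionGen q)) := by
  have : (fun N ↦ overpartitionProd N q) = fun N ↦
      ∑' n, ((∏ k ∈ range N, overpartitionFactor k).coeff n : ℂ) * q ^ n :=
    funext fun N ↦ (hasSum_prod_overpartitionFactor hq N).2.tsum_eq.symm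
  rw [this]
  refine tendsto_tsum_of_dominated_convergence
    (summable_overpartitionFn_mul_pow (norm_nonneg q) hq) (fun n ↦ ?_)
    (Eventually.of_forall fun N n ↦ ?_)
  · refine tendsto_const_nhds.congr' ?_
    filter_upwards [eventually_coeff_prod_overpartitionFactor n] with N hN
    rw [hN]
  · rw [norm_mul, norm_pow, Complex.norm_natCast]
    gcongr
    exact coeff_prod_overpartitionFactor_le N n

theorem overpartitionProd_succ (N : ℕ) (q : ℂ) :
    overpartitionProd (N + 1) q =
      overpartitionProd N q * ((1 + q ^ (N + 1)) / (1 - q ^ (N + 1))) :=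
  prod_range_succ _ _

theorem overpartitionProd_ne_zero {q : ℂ} (hq : ‖q‖ < 1) (N : ℕ) :
    overpartitionProd N q ≠ 0 :=
  prod_ne_zero_iff.mpr fun k _ ↦
    div_ne_zero (one_add_pow_ne_zero hq k) (one_sub_pow_ne_zero hq k)

/-- A finite form, due to Shanks, of Gauss's identity
`∑ (-1)^j q^(j^2) = ∏ (1 - q^k) / (1 + q^k)`. -/
theorem shanks_identity {q : ℂ} (hq : ‖q‖ < 1) (n : ℕ) :
    1 + ∑ j ∈ range n, 2 * (-1) ^ (j + 1) * q ^ ((j + 1) ^ 2) =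
      (overpartitionProd n q)⁻¹ * (1 + ∑ s ∈ range n,
        overpartitionProd (s + 1) q * (2 / (1 + q ^ (s + 1))) * (-1) ^ (s + 1) *
          q ^ ((s + 1) * (n + 1))) := by
  have step (n m : ℕ) :
      ((1 - q ^ (n + 1)) / (1 + q ^ (n + 1))) * (1 + ∑ s ∈ range m,
        overpartitionProd (s + 1) q * (2 / (1 + q ^ (s + 1))) * (-1) ^ (s + 1) *
          q ^ ((s + 1) * (n + 1 + 1))) = 1 + ∑ s ∈ range m,
        overpartitionProd (s + 1) q * (2 / (1 + q ^ (s + 1))) * (-1) ^ (s + 1) *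
          q ^ ((s + 1) * (n + 1)) - 2 / (1 + q ^ (n + 1)) * (-1) ^ m * overpartitionProd m q *
            q ^ ((m + 1) * (n + 1)) := by
    have h1 := one_add_pow_ne_zero hq n
    induction m with
    | zero =>
      simp [overpartitionProd]
      field_simp
      ring
    | succ m ih =>
      have h2 := one_add_pow_ne_zero hq m
      have h3 := one_sub_pow_ne_zero hq m
      rw [sum_range_succ, ← add_assoc, mul_add, ih, sum_range_succ, overpartitionProd_succ]
      have e1 : q ^ ((m + 1) * (n + 1 + 1)) = q ^ ((m + 1) * (n + 1)) * q ^ (m + 1) := by ring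
      have e2 : q ^ ((m + 1 + 1) * (n + 1)) = q ^ ((m + 1) * (n + 1)) * q ^ (n + 1) := by ring
      rw [e1, e2]
      generalize q ^ ((m + 1) * (n + 1)) = A at *
      generalize q ^ (m + 1) = B at *
      generalize q ^ (n + 1) = D at *
      generalize overpartitionProd m q = P at *
      generalize ∑ s ∈ range m, overpartitionProd (s + 1) q * (2 / (1 + q ^ (s + 1))) *
        (-1) ^ (s + 1) * q ^ ((s + 1) * (n + 1)) = S
      rw [pow_succ]
      field_simp
      ring
  induction n with
  | zero => simp [overpartitionProd]
  | succ n ih =>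
    have h1 := one_add_pow_ne_zero hq n
    have h3 := one_sub_pow_ne_zero hq n
    have h4 := overpartitionProd_ne_zero hq n
    have hst := step n n
    rw [sum_range_succ, ← add_assoc, ih, sum_range_succ _ n, ← add_assoc]
    have e : (overpartitionProd (n + 1) q)⁻¹ =
        (overpartitionProd n q)⁻¹ * ((1 - q ^ (n + 1)) / (1 + q ^ (n + 1))) := by
      rw [overpartitionProd_succ, mul_inv, inv_div]
    rw [e, mul_assoc (overpartitionProd n q)⁻¹, mul_add (_ / _) (1 + _) _, hst, overpartitionProd_succ]
    have e1 : q ^ ((n + 1) * (n + 1 + 1)) = q ^ ((n + 1) ^ 2) * q ^ (n + 1) := by ring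
    have e2 : q ^ ((n + 1) * (n + 1)) = q ^ ((n + 1) ^ 2) := by ring
    rw [e1, e2]
    generalize q ^ ((n + 1) ^ 2) = A at *
    generalize q ^ (n + 1) = B at *
    generalize overpartitionProd n q = P at *
    generalize ∑ s ∈ range n, overpartitionProd (s + 1) q * (2 / (1 + q ^ (s + 1))) *
      (-1) ^ (s + 1) * q ^ ((s + 1) * (n + 1)) = S
    rw [pow_succ]
    field_simp
    ring

theorem norm_overpartitionProd_le {q : ℂ} (hq : ‖q‖ < 1) (N : ℕ) :
    ‖overpartitionProd N q‖ ≤ ∏ k ∈ range N, (1 + ‖q‖ ^ (k + 1)) / (1 - ‖q‖ ^ (k + 1)) := by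
  rw [overpartitionProd, norm_prod]
  refine prod_le_prod (fun _ _ ↦ norm_nonneg _) fun k _ ↦ ?_
  have hk : ‖q‖ ^ (k + 1) < 1 := pow_lt_one₀ (norm_nonneg q) hq (Nat.succ_ne_zero k)
  rw [norm_div]
  have h1 := norm_add_le (1 : ℂ) (q ^ (k + 1))
  have h2 := norm_sub_norm_le (1 : ℂ) (q ^ (k + 1))
  rw [norm_one, norm_pow] at h1 h2
  have : 0 < 1 - ‖q‖ ^ (k + 1) := by linarith
  gcongr

theorem norm_inv_overpartitionProd_le {q : ℂ} (hq : ‖q‖ < 1) (N : ℕ) :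
    ‖(overpartitionProd N q)⁻¹‖ ≤
      ∏ k ∈ range N, (1 + ‖q‖ ^ (k + 1)) / (1 - ‖q‖ ^ (k + 1)) := by
  rw [overpartitionProd, ← prod_inv_distrib, norm_prod]
  refine prod_le_prod (fun _ _ ↦ norm_nonneg _) fun k _ ↦ ?_
  have hk : ‖q‖ ^ (k + 1) < 1 := pow_lt_one₀ (norm_nonneg q) hq (Nat.succ_ne_zero k)
  rw [inv_div, norm_div]
  have h1 := norm_sub_le (1 : ℂ) (q ^ (k + 1))
  have h2 := norm_sub_norm_le (1 : ℂ) (-q ^ (k + 1))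
  rw [sub_neg_eq_add, norm_neg] at h2
  rw [norm_one, norm_pow] at h1 h2
  have : 0 < 1 - ‖q‖ ^ (k + 1) := by linarith
  gcongr

theorem tendsto_inv_overpartitionProd {q : ℂ} (hq : ‖q‖ < 1) {θ : ℂ}
    (hθ : HasSum (fun n : ℤ ↦ (-1) ^ n * q ^ (n.natAbs ^ 2)) θ) :
    Tendsto (fun N ↦ (overpartitionProd N q)⁻¹) atTop (𝓝 θ) := by
  set B := Real.exp (2 / (1 - ‖q‖) * (1 - ‖q‖)⁻¹) with hB
  have hr : 0 < 1 - ‖q‖ := by linarith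
  have hP (N : ℕ) := (norm_overpartitionProd_le hq N).trans
    (prod_one_add_div_one_sub_le (norm_nonneg q) hq N)
  have hA (N : ℕ) := (norm_inv_overpartitionProd_le hq N).trans
    (prod_one_add_div_one_sub_le (norm_nonneg q) hq N)
  have hsum : Tendsto (fun n ↦ 1 + ∑ j ∈ range n, 2 * (-1) ^ (j + 1) * q ^ ((j + 1) ^ 2))
      atTop (𝓝 θ) := by
    have h := hθ.nat_add_neg.tendsto_sum_nat
    have h' := ((tendsto_add_atTop_iff_nat 1).mpr h).sub_const 1
    simp only [sum_range_succ'] at h'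
    convert h' using 1
    · ext n
      have : ∀ j : ℕ, (2 : ℂ) * (-1) ^ (j + 1) * q ^ ((j + 1) ^ 2) =
          (-1) ^ ((j + 1 : ℕ) : ℤ) * q ^ (((j + 1 : ℕ) : ℤ).natAbs ^ 2) +
          (-1) ^ (-((j + 1 : ℕ) : ℤ)) * q ^ ((-((j + 1 : ℕ) : ℤ)).natAbs ^ 2) := by
        intro j
        rw [Int.natAbs_neg, Int.natAbs_natCast, zpow_neg, zpow_natCast, ← inv_pow]
        norm_num
        ring
      simp only [this]
      simp
      ring
    · simp
  have herr : Tendsto (fun n : ℕ ↦ B * (B * (2 / (1 - ‖q‖)) * (n * ‖q‖ ^ n))) atTop (𝓝 0) := by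
    have := ((tendsto_self_mul_const_pow_of_lt_one (norm_nonneg q) hq).const_mul
      (B * (2 / (1 - ‖q‖)))).const_mul B
    simpa using this
  have hdiff : Tendsto (fun n ↦ (1 + ∑ j ∈ range n, 2 * (-1) ^ (j + 1) * q ^ ((j + 1) ^ 2)) -
      (overpartitionProd n q)⁻¹) atTop (𝓝 0) := by
    refine squeeze_zero_norm (fun n ↦ ?_) herr
    rw [shanks_identity hq, mul_add, mul_one, add_sub_cancel_left, norm_mul]
    have hterm : ∀ s ∈ range n, ‖overpartitionProd (s + 1) q * (2 / (1 + q ^ (s + 1))) *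
        (-1) ^ (s + 1) * q ^ ((s + 1) * (n + 1))‖ ≤ B * (2 / (1 - ‖q‖)) * ‖q‖ ^ n := by
      intro s _
      rw [norm_mul, norm_mul, norm_mul, norm_pow, norm_neg, norm_one, one_pow, mul_one, norm_div,
        norm_pow]
      have h2 := norm_sub_norm_le (1 : ℂ) (-q ^ (s + 1))
      rw [sub_neg_eq_add, norm_neg, norm_one, norm_pow] at h2
      have h3 : ‖q‖ ^ (s + 1) ≤ ‖q‖ := pow_le_of_le_one (norm_nonneg q) hq.le (Nat.succ_ne_zero s)
      have h4 : ‖q‖ ^ ((s + 1) * (n + 1)) ≤ ‖q‖ ^ n :=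
        pow_le_pow_of_le_one (norm_nonneg q) hq.le (by nlinarith)
      have h5 : ‖(2 : ℂ)‖ = 2 := by norm_num
      rw [h5]
      have h6 : 1 - ‖q‖ ≤ ‖1 + q ^ (s + 1)‖ := by linarith
      have := hP (s + 1)
      gcongr
    have hs := norm_sum_le_of_le _ hterm
    rw [sum_const, card_range, nsmul_eq_mul] at hs
    have := hA n
    gcongr
    linarith
  have := hsum.sub hdiff
  simpa using this

theorem overpartitionGen_mul_eq_one {q : ℂ} (hq : ‖q‖ < 1) {θ : ℂ}
    (hθ : HasSum (fun n : ℤ ↦ (-1) ^ n * q ^ (n.natAbs ^ 2)) θ) :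
    overpartitionGen q * θ = 1 := by
  refine tendsto_nhds_unique
    ((tendsto_overpartitionProd hq).mul (tendsto_inv_overpartitionProd hq hθ)) ?_
  refine tendsto_const_nhds.congr fun N ↦ ?_
  rw [mul_inv_cancel₀ (overpartitionProd_ne_zero hq N)]

theorem norm_one_add_div_one_sub_le {x : ℂ} (hx : ‖x‖ < 1) :
    ‖(1 + x) / (1 - x)‖ ≤ (1 + ‖x‖) / (1 - ‖x‖) * Real.exp (-(1 / 2) * (‖x‖ - x.re)) := by
  have h1 : ‖1 + x‖ ≤ 1 + ‖x‖ := by simpa using norm_add_le (1 : ℂ) x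
  have h2 : 1 - x.re ≤ ‖1 - x‖ := by simpa using Complex.re_le_norm (1 - x)
  have h3 := Complex.re_le_norm x
  have h4 := neg_le_of_abs_le (Complex.abs_re_le_norm x)
  have h5 := Real.add_one_le_exp (-(1 / 2) * (‖x‖ - x.re))
  have h6 : 1 - ‖x‖ ≤ ‖1 - x‖ * Real.exp (-(1 / 2) * (‖x‖ - x.re)) := by
    calc 1 - ‖x‖ ≤ (1 - x.re) * (-(1 / 2) * (‖x‖ - x.re) + 1) := by nlinarith
      _ ≤ _ := by gcongr; linarith
  have h7 : 0 < 1 - ‖x‖ := by linarith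
  have h8 : 0 < ‖1 - x‖ := by linarith
  rw [norm_div, div_mul_eq_mul_div, div_le_div_iff₀ h8 h7]
  calc ‖1 + x‖ * (1 - ‖x‖) ≤ (1 + ‖x‖) * (‖1 - x‖ * Real.exp (-(1 / 2) * (‖x‖ - x.re))) := by
        gcongr
    _ = _ := by ring

theorem norm_overpartitionGen_le {q : ℂ} (hq : ‖q‖ < 1) :
    ‖overpartitionGen q‖ ≤ ‖overpartitionGen (‖q‖ : ℂ)‖ *
      Real.exp (-(1 / 2) * ((1 - ‖q‖)⁻¹ - ‖1 - q‖⁻¹)) := by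
  have hq' : ‖(‖q‖ : ℂ)‖ < 1 := by simpa using hq
  have hfin (N : ℕ) : ‖overpartitionProd N q‖ ≤ ‖overpartitionProd N (‖q‖ : ℂ)‖ *
      Real.exp (-(1 / 2) * (∑ k ∈ range N, ‖q‖ ^ (k + 1) - ∑ k ∈ range N, (q ^ (k + 1)).re)) := by
    rw [← sum_sub_distrib, mul_sum, Real.exp_sum, overpartitionProd, overpartitionProd,
      norm_prod, norm_prod, ← prod_mul_distrib]
    refine prod_le_prod (fun _ _ ↦ norm_nonneg _) fun k _ ↦ ?_
    have hk : ‖q‖ ^ (k + 1) < 1 := pow_lt_one₀ (norm_nonneg q) hq (Nat.succ_ne_zero k)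
    have h := norm_one_add_div_one_sub_le (x := q ^ (k + 1)) (by rwa [norm_pow])
    rw [norm_pow] at h
    refine h.trans_eq ?_
    congr 1
    have e : (1 + (‖q‖ : ℂ) ^ (k + 1)) / (1 - (‖q‖ : ℂ) ^ (k + 1)) =
        (((1 + ‖q‖ ^ (k + 1)) / (1 - ‖q‖ ^ (k + 1)) : ℝ) : ℂ) := by push_cast; rfl
    rw [e, Complex.norm_real, Real.norm_of_nonneg]
    have : 0 ≤ ‖q‖ ^ (k + 1) := by positivity
    apply div_nonneg <;> linarith
  have hs1 : Tendsto (fun N ↦ ∑ k ∈ range N, ‖q‖ ^ (k + 1)) atTop (𝓝 ((1 - ‖q‖)⁻¹ * ‖q‖)) := by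
    simpa only [pow_succ] using
      ((hasSum_geometric_of_lt_one (norm_nonneg q) hq).mul_right ‖q‖).tendsto_sum_nat
  have hs2 : Tendsto (fun N ↦ ∑ k ∈ range N, (q ^ (k + 1)).re) atTop
      (𝓝 ((1 - q)⁻¹ * q).re) := by
    simpa only [pow_succ] using
      (Complex.hasSum_re ((hasSum_geometric_of_norm_lt_one hq).mul_right q)).tendsto_sum_nat
  have hlim := le_of_tendsto_of_tendsto' (tendsto_overpartitionProd hq).norm
    ((tendsto_overpartitionProd hq').norm.mul
      (Real.continuous_exp.continuousAt.tendsto.comp ((hs1.sub hs2).const_mul (-(1 / 2))))) hfin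
  refine hlim.trans ?_
  gcongr ?_ * ?_
  refine Real.exp_le_exp.mpr ?_
  have hne : 1 - q ≠ 0 := by simpa using one_sub_pow_ne_zero hq 0
  have hr : 1 - ‖q‖ ≠ 0 := by linarith
  have e1 : (1 - ‖q‖)⁻¹ * ‖q‖ = (1 - ‖q‖)⁻¹ - 1 := by field_simp; ring
  have e2 : (1 - q)⁻¹ * q = (1 - q)⁻¹ - 1 := by field_simp; ring
  have h3 := Complex.re_le_norm (1 - q)⁻¹
  rw [norm_inv] at h3
  rw [e1, e2, Complex.sub_re, Complex.one_re]
  linarith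

theorem norm_cexp_neg_pi_mul (w : ℂ) :
    ‖Complex.exp (-Real.pi * w)‖ = Real.exp (-Real.pi * w.re) := by
  rw [Complex.norm_exp, ← Complex.ofReal_neg, Complex.re_ofReal_mul]

theorem norm_cexp_neg_pi_mul_lt_one {w : ℂ} (hw : 0 < w.re) :
    ‖Complex.exp (-Real.pi * w)‖ < 1 := by
  rw [norm_cexp_neg_pi_mul, Real.exp_lt_one_iff]
  nlinarith [Real.pi_pos]

/-- On the part of the circle `|q| = e^(-π y)` away from `q = 1` the generating function is
exponentially smaller than at the positive real point. -/
theorem norm_overpartitionGen_le_of_minor {w : ℂ} (hw : 0 < w.re) (hw8 : w.re ≤ 1 / 8)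
    (him : 3 / 4 * w.re ≤ |w.im|) (him1 : |w.im| ≤ 1) :
    ‖overpartitionGen (Complex.exp (-Real.pi * w))‖ ≤
      ‖overpartitionGen (Complex.exp (-Real.pi * (w.re : ℂ)))‖ *
        Real.exp (-(1 / (264 * w.re))) := by
  have hq := norm_cexp_neg_pi_mul_lt_one hw
  have h := norm_overpartitionGen_le hq
  have hnorm : (‖Complex.exp (-Real.pi * w)‖ : ℂ) = Complex.exp (-Real.pi * (w.re : ℂ)) := by
    rw [norm_cexp_neg_pi_mul]; push_cast; rfl
  rw [hnorm] at h
  refine h.trans ?_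
  gcongr ?_ * ?_
  refine Real.exp_le_exp.mpr ?_
  rw [norm_cexp_neg_pi_mul] at hq ⊢
  set r := Real.exp (-Real.pi * w.re) with hr
  set y := w.re with hy
  have hr1 : 0 < 1 - r := by linarith
  have hle : 1 - r ≤ 4 * y := by
    have := Real.add_one_le_exp (-Real.pi * y)
    nlinarith [Real.pi_le_four]
  have hr2 : 1 / 2 ≤ r := by linarith
  have hsq : ‖1 - Complex.exp (-Real.pi * w)‖ ^ 2 =
      (1 - r) ^ 2 + 2 * r * (1 - Real.cos (Real.pi * w.im)) := by
    have e : Complex.exp (-Real.pi * w) =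
        (r * Real.cos (Real.pi * w.im) : ℝ) + (-(r * Real.sin (Real.pi * w.im)) : ℝ) * Complex.I := by
      have : -Real.pi * w = ((-Real.pi * y : ℝ) : ℂ) + ((-(Real.pi * w.im) : ℝ) : ℂ) * Complex.I := by
        apply Complex.ext <;> simp [hy]
      rw [this, Complex.exp_add, Complex.exp_mul_I, ← Complex.ofReal_exp, ← hr, ← Complex.ofReal_cos,
        ← Complex.ofReal_sin, Real.cos_neg, Real.sin_neg]
      push_cast
      ring
    have hsc := Real.sin_sq_add_cos_sq (Real.pi * w.im)
    rw [e, ← Complex.normSq_eq_norm_sq, Complex.normSq_apply]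
    generalize Real.sin (Real.pi * w.im) = a at *
    generalize Real.cos (Real.pi * w.im) = b at *
    simp only [Complex.sub_re, Complex.sub_im, Complex.one_re, Complex.one_im, Complex.add_re,
      Complex.add_im, Complex.ofReal_re, Complex.ofReal_im, Complex.re_ofReal_mul,
      Complex.im_ofReal_mul, Complex.I_re, Complex.I_im]
    linear_combination r ^ 2 * hsc
  have hcos : 2 * w.im ^ 2 ≤ 1 - Real.cos (Real.pi * w.im) := by
    have := Real.cos_le_one_sub_mul_cos_sq (x := Real.pi * w.im) (by
      rw [abs_mul, abs_of_pos Real.pi_pos]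
      exact mul_le_of_le_one_right Real.pi_pos.le him1)
    have e : 2 / Real.pi ^ 2 * (Real.pi * w.im) ^ 2 = 2 * w.im ^ 2 := by
      have := Real.pi_ne_zero
      field_simp
    linarith
  have him2 : (3 / 4 * y) ^ 2 ≤ w.im ^ 2 := by
    rw [← sq_abs w.im]
    gcongr
  have hlow : 33 / 32 * (1 - r) ≤ ‖1 - Complex.exp (-Real.pi * w)‖ := by
    refine (pow_le_pow_iff_left₀ (by linarith) (norm_nonneg _) two_ne_zero).mp ?_
    rw [hsq]
    have h1 : (1 - r) ^ 2 ≤ (4 * y) ^ 2 := by gcongr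
    have h2 : 2 * (3 / 4 * y) ^ 2 ≤ 2 * r * (1 - Real.cos (Real.pi * w.im)) := by
      nlinarith [sq_nonneg w.im]
    nlinarith
  have hinv : ‖1 - Complex.exp (-Real.pi * w)‖⁻¹ ≤ 32 / 33 * (1 - r)⁻¹ := by
    have := inv_anti₀ (by positivity) hlow
    rw [mul_inv] at this
    norm_num at this ⊢
    exact this
  have hinv2 : (4 * y)⁻¹ ≤ (1 - r)⁻¹ := inv_anti₀ hr1 hle
  have e : 1 / (264 * y) = (4 * y)⁻¹ / 66 := by field_simp; norm_num
  rw [e]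
  linarith

theorem hasSum_neg_one_pow_mul_cexp {w : ℂ} (hw : 0 < w.re) :
    HasSum (fun n : ℤ ↦ (-1) ^ n * Complex.exp (-Real.pi * w) ^ (n.natAbs ^ 2))
      (jacobiTheta₂ (1 / 2) (Complex.I * w)) := by
  have h := hasSum_jacobiTheta₂_term (1 / 2) (τ := Complex.I * w) (by simpa using hw)
  convert h using 1
  ext n
  rw [jacobiTheta₂_term, Complex.exp_add]
  congr 1
  · rw [show 2 * Real.pi * Complex.I * n * (1 / 2) = n * (Real.pi * Complex.I) by ring,
      Complex.exp_int_mul, Complex.exp_pi_mul_I]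
  · rw [← Complex.exp_nat_mul]
    congr 1
    have : ((n.natAbs ^ 2 : ℕ) : ℂ) = (n : ℂ) ^ 2 := by
      rw [← Int.cast_natCast, Nat.cast_pow, Int.natAbs_sq, Int.cast_pow]
    rw [this]
    linear_combination (-(Real.pi : ℂ) * n ^ 2 * w) * Complex.I_sq

theorem jacobiTheta₂_half_eq {w : ℂ} (hw : 0 < w.re) :
    jacobiTheta₂ (1 / 2) (Complex.I * w) =
      1 / w ^ (1 / 2 : ℂ) * Complex.exp (-(Real.pi / (4 * w))) *
        ∑' n : ℕ, 2 * Complex.exp (-(Real.pi * (n * (n + 1)) * w⁻¹)) := by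
  have hw0 : w ≠ 0 := by rintro rfl; simp at hw
  have hI := Complex.I_ne_zero
  have hinv : 0 < (w⁻¹).re := by
    rw [Complex.inv_re]
    exact div_pos hw (Complex.normSq_pos.mpr hw0)
  rw [jacobiTheta₂_functional_equation]
  congr 1
  · congr 2
    · rw [← mul_assoc, neg_mul, Complex.I_mul_I]
      simp
    · field_simp
      norm_num
  · have hτ : -1 / (Complex.I * w) = Complex.I * w⁻¹ := by
      field_simp
      simp
    have h := hasSum_jacobiTheta₂_term (1 / 2 / (Complex.I * w)) (τ := Complex.I * w⁻¹)
      (by simpa using hinv)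
    rw [hτ, ← ((Equiv.addRight (1 : ℤ)).hasSum_iff.mpr h).nat_add_neg_add_one.tsum_eq]
    refine tsum_congr fun n ↦ ?_
    simp only [Function.comp, Equiv.coe_addRight, jacobiTheta₂_term]
    rw [two_mul (Complex.exp _)]
    have hz : 1 / 2 / (Complex.I * w) = -Complex.I / 2 * w⁻¹ := by
      field_simp
      simp
    rw [hz]
    push_cast
    congr 2
    · linear_combination (-(Real.pi : ℂ) * w⁻¹ * (n + 1) - (-(Real.pi : ℂ)) * w⁻¹ * (n + 1) ^ 2) *
        Complex.I_sq
    · linear_combination ((Real.pi : ℂ) * w⁻¹ * n + (Real.pi : ℂ) * w⁻¹ * n ^ 2) * Complex.I_sq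

theorem norm_tsum_cexp_sub_one_le {s : ℂ} (hs : 1 / 2 ≤ s.re) :
    ‖(∑' n : ℕ, Complex.exp (-(Real.pi * (n * (n + 1)) * s))) - 1‖ ≤
      2 * Real.exp (-(2 * Real.pi * s.re)) := by
  have hπ := Real.pi_gt_three
  set u := Real.exp (-(2 * Real.pi * s.re)) with hu
  have hu2 : u ≤ 1 / 2 := by
    have h1 : u ≤ Real.exp (-1) := Real.exp_le_exp.mpr (by nlinarith)
    have h2 := Real.exp_neg_one_lt_half
    linarith
  have hu0 : 0 < u := Real.exp_pos _
  have hb (n : ℕ) : ‖Complex.exp (-(Real.pi * (n * (n + 1)) * s))‖ ≤ u ^ n := by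
    rw [Complex.norm_exp, hu, ← Real.exp_nat_mul]
    refine Real.exp_le_exp.mpr ?_
    have e : -(Real.pi * (n * (n + 1)) * s) = ((-(Real.pi * (n * (n + 1))) : ℝ) : ℂ) * s := by
      push_cast; ring
    rw [e, Complex.re_ofReal_mul]
    have : (2 : ℝ) * n ≤ n * (n + 1) := by
      rcases Nat.eq_zero_or_pos n with rfl | hn
      · simp
      · have : (1 : ℝ) ≤ n := by exact_mod_cast hn
        nlinarith
    have h' : 0 ≤ Real.pi * s.re := by positivity
    nlinarith
  have hgeo := summable_geometric_of_lt_one hu0.le (by linarith : u < 1)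
  have hsum : Summable fun n : ℕ ↦ Complex.exp (-(Real.pi * (n * (n + 1)) * s)) :=
    hgeo.of_norm_bounded hb
  rw [hsum.tsum_eq_zero_add]
  simp only [Nat.cast_zero, zero_mul, mul_zero, neg_zero, Complex.exp_zero, add_sub_cancel_left]
  refine (tsum_of_norm_bounded
    (((hasSum_geometric_of_lt_one hu0.le (by linarith : u < 1))).mul_right u)
    fun n ↦ (hb (n + 1)).trans_eq (pow_succ u n)).trans ?_
  gcongr
  rw [inv_le_comm₀ (by linarith) (by norm_num)]
  linarith

theorem norm_overpartitionGen_sub_le {w : ℂ} (hw : 0 < w.re) (hinv : 1 / 2 ≤ (w⁻¹).re) :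
    ‖overpartitionGen (Complex.exp (-Real.pi * w)) -
      1 / 2 * w ^ (1 / 2 : ℂ) * Complex.exp (Real.pi / (4 * w))‖ ≤
      ‖1 / 2 * w ^ (1 / 2 : ℂ) * Complex.exp (Real.pi / (4 * w))‖ *
        (4 * Real.exp (-(2 * Real.pi * (w⁻¹).re))) := by
  have hw0 : w ≠ 0 := by rintro rfl; simp at hw
  have h := overpartitionGen_mul_eq_one (norm_cexp_neg_pi_mul_lt_one hw)
    (hasSum_neg_one_pow_mul_cexp hw)
  rw [jacobiTheta₂_half_eq hw, tsum_mul_left, Complex.exp_neg] at h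
  have hE := norm_tsum_cexp_sub_one_le hinv
  set E := ∑' n : ℕ, Complex.exp (-(Real.pi * (n * (n + 1)) * w⁻¹)) with hEdef
  have hwh : w ^ (1 / 2 : ℂ) ≠ 0 := by simp [Complex.cpow_eq_zero_iff, hw0]
  have hexp := Complex.exp_ne_zero (Real.pi / (4 * w))
  have hu : Real.exp (-(2 * Real.pi * (w⁻¹).re)) ≤ 1 / 4 := by
    have h1 : Real.exp (-(2 * Real.pi * (w⁻¹).re)) ≤ Real.exp (-1 + -1) :=
      Real.exp_le_exp.mpr (by nlinarith [Real.pi_gt_three])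
    rw [Real.exp_add] at h1
    nlinarith [Real.exp_neg_one_lt_half, Real.exp_pos (-1)]
  have hE2 : 1 / 2 ≤ ‖E‖ := by
    have := norm_sub_norm_le (1 : ℂ) (1 - E)
    rw [sub_sub_cancel, norm_one, norm_sub_rev] at this
    linarith
  have hE0 : E ≠ 0 := norm_pos_iff.mp (by linarith)
  have hG : overpartitionGen (Complex.exp (-Real.pi * w)) =
      1 / 2 * w ^ (1 / 2 : ℂ) * Complex.exp (Real.pi / (4 * w)) * E⁻¹ := by
    field_simp at h ⊢
    linear_combination h
  rw [hG, ← mul_sub_one, norm_mul]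
  gcongr
  have e : E⁻¹ - 1 = -(E - 1) * E⁻¹ := by field_simp; ring
  rw [e, norm_mul, norm_neg, norm_inv]
  have : ‖E‖⁻¹ ≤ 2 := by
    rw [inv_le_comm₀ (by linarith) (by norm_num)]
    linarith
  calc ‖E - 1‖ * ‖E‖⁻¹ ≤ (2 * Real.exp (-(2 * Real.pi * (w⁻¹).re))) * 2 := by gcongr
    _ = _ := by ring

/-- The rescaled saddle-point integrand. -/
noncomputable def saddleIntegrand (μ : ℝ) (w : ℂ) : ℂ :=
  w ^ (1 / 2 : ℂ) * Complex.exp (μ / 2 * (w + w⁻¹))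

theorem norm_cpow_half_sq (w : ℂ) : ‖w ^ (1 / 2 : ℂ)‖ ^ 2 = ‖w‖ := by
  rw [← norm_pow]
  congr 1
  simpa only [one_div, Nat.cast_ofNat] using Complex.cpow_nat_inv_pow w two_ne_zero

theorem norm_saddleIntegrand_le {μ : ℝ} (hμ : 0 ≤ μ) {w : ℂ} (hw : ‖w‖ ≤ 4) {c : ℝ}
    (hc : (w + w⁻¹).re ≤ 2 * c) : ‖saddleIntegrand μ w‖ ≤ 2 * Real.exp (c * μ) := by
  have h1 : ‖w ^ (1 / 2 : ℂ)‖ ≤ 2 := by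
    refine (pow_le_pow_iff_left₀ (norm_nonneg _) zero_le_two two_ne_zero).mp ?_
    rw [norm_cpow_half_sq]
    linarith
  have h2 : ‖Complex.exp (μ / 2 * (w + w⁻¹))‖ ≤ Real.exp (c * μ) := by
    rw [Complex.norm_exp]
    refine Real.exp_le_exp.mpr ?_
    have e : (μ : ℂ) / 2 * (w + w⁻¹) = ((μ / 2 : ℝ) : ℂ) * (w + w⁻¹) := by push_cast; rfl
    rw [e, Complex.re_ofReal_mul]
    nlinarith
  rw [saddleIntegrand, norm_mul]
  gcongr

theorem re_pos_of_mem_ball_one {w : ℂ} (hw : w ∈ Metric.ball (1 : ℂ) 1) : 0 < w.re := by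
  rw [mem_ball_iff_norm'] at hw
  have := (Complex.re_le_norm (1 - w)).trans_lt hw
  simp at this
  exact this

theorem exists_primitive_saddleIntegrand (μ : ℝ) :
    ∃ F : ℂ → ℂ, ∀ w ∈ Metric.ball (1 : ℂ) 1, HasDerivAt F (saddleIntegrand μ w) w := by
  refine DifferentiableOn.isExactOn_ball fun w hw ↦ DifferentiableAt.differentiableWithinAt ?_
  have hre := re_pos_of_mem_ball_one hw
  have h0 : w ≠ 0 := by rintro rfl; simp at hre
  have hs : w ∈ Complex.slitPlane := Or.inl hre
  unfold saddleIntegrand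
  refine DifferentiableAt.mul ?_ ?_
  · exact (hasStrictDerivAt_id w).cpow_const hs |>.hasDerivAt.differentiableAt
  · exact (((differentiableAt_id.add (differentiableAt_inv h0))).const_mul _).cexp

theorem norm_radial_primitive_sub_le {μ : ℝ} (hμ : 0 ≤ μ) {F : ℂ → ℂ}
    (hF : ∀ w ∈ Metric.ball (1 : ℂ) 1, HasDerivAt F (saddleIntegrand μ w) w) {v : ℂ}
    (hre : v.re = 4 / 5) (him : v.im ^ 2 = 9 / 25) :
    ‖F ((5 / 4 : ℝ) * v) - F v‖ ≤ 2 * Real.exp (9 / 10 * μ) := by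
  have hnsq : Complex.normSq v = 1 := by
    rw [Complex.normSq_apply, hre, ← sq v.im, him]; norm_num
  have hnorm : ‖v‖ = 1 := by
    have := Complex.normSq_eq_norm_sq v
    rw [hnsq] at this
    nlinarith [norm_nonneg v]
  have hmem (ρ : ℝ) (h1 : 1 ≤ ρ) (h2 : ρ ≤ 5 / 4) : (ρ : ℂ) * v ∈ Metric.ball (1 : ℂ) 1 := by
    rw [mem_ball_iff_norm]
    refine (pow_lt_pow_iff_left₀ (norm_nonneg _) zero_le_one two_ne_zero).mp ?_
    rw [← Complex.normSq_eq_norm_sq, Complex.normSq_apply]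
    simp only [Complex.sub_re, Complex.re_ofReal_mul, Complex.one_re, Complex.sub_im,
      Complex.im_ofReal_mul, Complex.one_im, hre]
    nlinarith
  have h := norm_image_sub_le_of_norm_deriv_le_segment' (a := 1) (b := 5 / 4)
    (f := fun ρ : ℝ ↦ F (ρ * v)) (f' := fun ρ : ℝ ↦ saddleIntegrand μ (ρ * v) * v)
    (C := 2 * Real.exp (9 / 10 * μ)) (fun ρ hρ ↦ ?_) (fun ρ hρ ↦ ?_) (5 / 4)
    (Set.right_mem_Icc.mpr (by norm_num))
  · refine (h.trans' (by simp)).trans ?_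
    have := Real.exp_pos (9 / 10 * μ)
    linarith
  · have hd : HasDerivAt (fun ρ : ℝ ↦ (ρ : ℂ) * v) v ρ := by
      simpa using (Complex.ofRealCLM.hasDerivAt (x := ρ)).mul_const v
    exact ((hF _ (hmem ρ hρ.1 hρ.2)).comp ρ hd).hasDerivWithinAt
  · have h1 := hρ.1
    have h2 := hρ.2
    have hρ0 : 0 < ρ := by linarith
    rw [norm_mul, hnorm, mul_one]
    refine norm_saddleIntegrand_le hμ ?_ ?_
    · rw [norm_mul, hnorm, Complex.norm_real, Real.norm_of_nonneg hρ0.le]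
      linarith
    · rw [mul_inv, Complex.add_re, ← Complex.ofReal_inv, Complex.re_ofReal_mul,
        Complex.re_ofReal_mul, Complex.inv_re, hnsq, hre]
      have : ρ⁻¹ ≤ 1 := inv_le_one_of_one_le₀ h1
      linarith

theorem saddleIntegrand_exp {μ α : ℝ} (h1 : -(Real.pi / 2) < α) (h2 : α ≤ Real.pi / 2) :
    saddleIntegrand μ (Complex.exp (2 * α * Complex.I)) =
      Complex.exp (α * Complex.I) * Real.exp (μ * (1 - 2 * Real.sin α ^ 2)) := by
  rw [saddleIntegrand, Complex.cpow_def_of_ne_zero (Complex.exp_ne_zero _), Complex.log_exp,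
    ← Complex.exp_neg]
  · congr 1
    · congr 1; ring
    · have e : (1 : ℂ) - 2 * Complex.sin α ^ 2 = Complex.cos (2 * α) := by
        rw [Complex.cos_two_mul']
        linear_combination -Complex.sin_sq_add_cos_sq (α : ℂ)
      push_cast
      rw [e, Complex.cos, neg_mul]
      congr 1
      ring
  all_goals
    simp
    linarith

/-- An explicit primitive of `s ↦ (1 - 4 s²) exp (μ (1 - 2 s²))`. -/
noncomputable def gaussianPrimitive (μ s : ℝ) : ℝ :=
  Real.exp μ * ((1 - 1 / μ) * (∫ t in (0)..s, Real.exp (-(2 * μ) * t ^ 2)) +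
    1 / μ * (s * Real.exp (-(2 * μ) * s ^ 2)))

theorem hasDerivAt_gaussianPrimitive {μ : ℝ} (hμ : μ ≠ 0) (s : ℝ) :
    HasDerivAt (gaussianPrimitive μ) ((1 - 4 * s ^ 2) * Real.exp (μ * (1 - 2 * s ^ 2))) s := by
  have hc : Continuous fun t : ℝ ↦ Real.exp (-(2 * μ) * t ^ 2) := by fun_prop
  have h1 := intervalIntegral.integral_hasDerivAt_right (hc.intervalIntegrable 0 s)
    (hc.stronglyMeasurableAtFilter _ _) hc.continuousAt
  have h2 := (hasDerivAt_id s).mul ((((hasDerivAt_id s).pow 2).const_mul (-(2 * μ))).exp)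
  have h3 := ((h1.const_mul (1 - 1 / μ)).add (h2.const_mul (1 / μ))).const_mul (Real.exp μ)
  refine h3.congr_deriv ?_
  have e : Real.exp (μ * (1 - 2 * s ^ 2)) = Real.exp μ * Real.exp (-(2 * μ) * s ^ 2) := by
    rw [← Real.exp_add]; ring_nf
  rw [e]
  simp
  field_simp
  ring

theorem abs_gaussianPrimitive_sub_le {μ : ℝ} (hμ : 1 ≤ μ) {s : ℝ} (hs : 0 ≤ s)
    (hs2 : s ^ 2 = 1 / 10) :
    |gaussianPrimitive μ s - Real.exp μ * ((1 - 1 / μ) * (√(Real.pi / (2 * μ)) / 2))| ≤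
      2 * Real.exp (9 / 10 * μ) := by
  have hμ0 : 0 < μ := by linarith
  have hint (b : ℝ) (hb : 0 < b) : MeasureTheory.Integrable fun t : ℝ ↦ Real.exp (-b * t ^ 2) :=
    integrable_exp_neg_mul_sq hb
  have hsplit := intervalIntegral.integral_interval_add_Ioi (a := 0) (b := s)
    (hint (2 * μ) (by positivity)).integrableOn (hint (2 * μ) (by positivity)).integrableOn
  rw [integral_gaussian_Ioi] at hsplit
  set T := ∫ t in Set.Ioi s, Real.exp (-(2 * μ) * t ^ 2) with hT
  have hT0 : 0 ≤ T := MeasureTheory.integral_nonneg fun t ↦ (Real.exp_pos _).le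
  have hT1 : T ≤ Real.exp (-(μ / 10)) := by
    have h1 : T ≤ ∫ t in Set.Ioi s, Real.exp (-(μ / 10)) * Real.exp (-μ * t ^ 2) := by
      refine MeasureTheory.setIntegral_mono_on (hint (2 * μ) (by positivity)).integrableOn
        ((hint μ hμ0).const_mul _).integrableOn measurableSet_Ioi fun t ht ↦ ?_
      rw [← Real.exp_add]
      refine Real.exp_le_exp.mpr ?_
      have : s ^ 2 ≤ t ^ 2 := pow_le_pow_left₀ hs (le_of_lt ht) 2
      nlinarith
    have h2 : ∫ t in Set.Ioi s, Real.exp (-μ * t ^ 2) ≤ ∫ t in Set.Ioi 0, Real.exp (-μ * t ^ 2) :=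
      MeasureTheory.setIntegral_mono_set (hint μ hμ0).integrableOn
        (Eventually.of_forall fun t ↦ (Real.exp_pos _).le)
        (Set.Ioi_subset_Ioi hs).eventuallyLE
    rw [integral_gaussian_Ioi] at h2
    have h3 : √(Real.pi / μ) ≤ 2 := by
      rw [Real.sqrt_le_left (by norm_num), div_le_iff₀ hμ0]
      nlinarith [Real.pi_le_four]
    rw [MeasureTheory.integral_const_mul] at h1
    have := Real.exp_pos (-(μ / 10))
    nlinarith
  have hμi : 0 < 1 / μ := by positivity
  have hμi1 : 1 / μ ≤ 1 := by rw [div_le_one hμ0]; exact hμ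
  have hs1 : s ≤ 1 := by nlinarith
  have hE : Real.exp (-(2 * μ) * s ^ 2) ≤ Real.exp (-(μ / 10)) := by
    refine Real.exp_le_exp.mpr ?_
    rw [hs2]; linarith
  have e : gaussianPrimitive μ s - Real.exp μ * ((1 - 1 / μ) * (√(Real.pi / (2 * μ)) / 2)) =
      Real.exp μ * (1 / μ * (s * Real.exp (-(2 * μ) * s ^ 2)) - (1 - 1 / μ) * T) := by
    rw [gaussianPrimitive, ← hsplit]; ring
  have hb1 : 1 / μ * (s * Real.exp (-(2 * μ) * s ^ 2)) ≤ 1 * (1 * Real.exp (-(μ / 10))) := by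
    gcongr
  have hb2 : (1 - 1 / μ) * T ≤ 1 * Real.exp (-(μ / 10)) := by
    gcongr
    linarith
  have hb3 : 0 ≤ 1 / μ * (s * Real.exp (-(2 * μ) * s ^ 2)) := by positivity
  have hb4 : 0 ≤ (1 - 1 / μ) * T := mul_nonneg (by linarith) hT0
  have e2 : Real.exp (9 / 10 * μ) = Real.exp μ * Real.exp (-(μ / 10)) := by
    rw [← Real.exp_add]; ring_nf
  rw [e, abs_mul, abs_of_pos (Real.exp_pos μ), e2, mul_left_comm 2]
  refine mul_le_mul_of_nonneg_left ?_ (Real.exp_pos μ).le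
  rw [abs_le]
  constructor <;> linarith

theorem arc_primitive_sub_eq {μ : ℝ} (hμ : 0 < μ) {F : ℂ → ℂ}
    (hF : ∀ w ∈ Metric.ball (1 : ℂ) 1, HasDerivAt F (saddleIntegrand μ w) w) :
    ∃ s : ℝ, 0 ≤ s ∧ s ^ 2 = 1 / 10 ∧
      F (4 / 5 + 3 / 5 * Complex.I) - F (4 / 5 - 3 / 5 * Complex.I) =
        4 * Complex.I * gaussianPrimitive μ s := by
  set φ := Real.arccos (4 / 5) with hφ
  have hφ0 : 0 ≤ φ := Real.arccos_nonneg _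
  have hφ1 : φ ≤ Real.pi / 2 := Real.arccos_le_pi_div_two.mpr (by norm_num)
  have hcos : Real.cos φ = 4 / 5 := Real.cos_arccos (by norm_num) (by norm_num)
  have hsin : Real.sin φ = 3 / 5 := by
    rw [hφ, Real.sin_arccos, Real.sqrt_eq_iff_mul_self_eq_of_pos (by norm_num)]
    norm_num
  have hmem (β : ℝ) (h : 4 / 5 ≤ Real.cos β) :
      Complex.exp (β * Complex.I) ∈ Metric.ball (1 : ℂ) 1 := by
    rw [mem_ball_iff_norm]
    refine (pow_lt_pow_iff_left₀ (norm_nonneg _) zero_le_one two_ne_zero).mp ?_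
    rw [← Complex.normSq_eq_norm_sq, Complex.normSq_apply]
    simp only [Complex.sub_re, Complex.exp_ofReal_mul_I_re, Complex.one_re, Complex.sub_im,
      Complex.exp_ofReal_mul_I_im, Complex.one_im]
    nlinarith [Real.sin_sq_add_cos_sq β]
  have hder (α : ℝ) (h0 : 0 ≤ α) (h1 : α ≤ φ / 2) : HasDerivAt (fun α : ℝ ↦
      F (Complex.exp (2 * α * Complex.I)) - F (Complex.exp (2 * (-α : ℝ) * Complex.I)) -
        4 * Complex.I * gaussianPrimitive μ (Real.sin α)) 0 α := by
    have hc : 4 / 5 ≤ Real.cos (2 * α) := by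
      rw [← hcos]
      exact Real.cos_le_cos_of_nonneg_of_le_pi (by linarith) (by linarith [Real.pi_pos])
        (by linarith)
    have hid : HasDerivAt (fun α : ℝ ↦ (α : ℂ)) 1 α := Complex.ofRealCLM.hasDerivAt
    have hid' : HasDerivAt (fun α : ℝ ↦ -(α : ℂ)) (-1) α := hid.neg
    have hm1 := hmem (2 * α) hc
    have hm2 := hmem (2 * (-α)) (by rwa [mul_neg, Real.cos_neg])
    push_cast at hm1 hm2
    have d1 := (hF _ hm1).comp α ((((hid.const_mul 2).mul_const Complex.I)).cexp)
    have d2 := (hF _ hm2).comp α ((((hid'.const_mul 2).mul_const Complex.I)).cexp)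
    have d3 := ((hasDerivAt_gaussianPrimitive hμ.ne' (Real.sin α)).comp α
      (Real.hasDerivAt_sin α)).ofReal_comp.const_mul (4 * Complex.I)
    simp only [Complex.ofReal_neg]
    refine ((d1.sub d2).sub d3).congr_deriv ?_
    have s1 := saddleIntegrand_exp (μ := μ) (α := α) (by linarith [Real.pi_pos])
      (by linarith [Real.pi_pos])
    have s2 := saddleIntegrand_exp (μ := μ) (α := -α) (by linarith [Real.pi_pos])
      (by linarith [Real.pi_pos])
    rw [Real.sin_neg, neg_sq] at s2
    push_cast at s1 s2
    rw [s1, s2]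
    have e1 : Complex.exp (2 * α * Complex.I) = Complex.exp (α * Complex.I) ^ 2 := by
      rw [← Complex.exp_nat_mul]; push_cast; ring_nf
    have e2 : Complex.exp (2 * -α * Complex.I) = Complex.exp (-α * Complex.I) ^ 2 := by
      rw [← Complex.exp_nat_mul]; push_cast; ring_nf
    rw [e1, e2, Complex.exp_mul_I, Complex.exp_mul_I, Complex.cos_neg, Complex.sin_neg]
    push_cast
    have hsc := Complex.sin_sq_add_cos_sq α
    have hcc : Complex.cos α ^ 2 = 1 - Complex.sin α ^ 2 := by linear_combination hsc
    generalize Complex.exp (μ * (1 - 2 * Complex.sin α ^ 2)) = E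
    generalize Complex.cos α = c at *
    generalize Complex.sin α = s at *
    have hc3 : c ^ 3 = c * (1 - s ^ 2) := by rw [← hcc]; ring
    linear_combination (4 * Complex.I * E) * hc3 + 12 * Complex.I * E * c * s ^ 2 * Complex.I_sq
  have hconst := norm_image_sub_le_of_norm_deriv_le_segment' (a := 0) (b := φ / 2) (C := 0)
    (f' := fun _ ↦ 0)
    (fun α hα ↦ (hder α hα.1 hα.2).hasDerivWithinAt) (by simp) (φ / 2)
    (Set.right_mem_Icc.mpr (by linarith))
  refine ⟨Real.sin (φ / 2), Real.sin_nonneg_of_nonneg_of_le_pi (by linarith) (by linarith), ?_, ?_⟩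
  · have := Real.cos_two_mul' (φ / 2)
    rw [mul_div_cancel₀ _ two_ne_zero, hcos] at this
    linarith [Real.sin_sq_add_cos_sq (φ / 2)]
  · have hz := norm_le_zero_iff.mp (hconst.trans_eq (zero_mul _))
    have hg0 : gaussianPrimitive μ 0 = 0 := by simp [gaussianPrimitive]
    have e1 : Complex.exp (2 * (φ / 2 : ℝ) * Complex.I) = 4 / 5 + 3 / 5 * Complex.I := by
      rw [show (2 : ℂ) * (φ / 2 : ℝ) = (φ : ℂ) by push_cast; ring, Complex.exp_mul_I,
        ← Complex.ofReal_cos, ← Complex.ofReal_sin, hcos, hsin]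
      push_cast; rfl
    have e2 : Complex.exp (2 * (-(φ / 2) : ℝ) * Complex.I) = 4 / 5 - 3 / 5 * Complex.I := by
      rw [show (2 : ℂ) * (-(φ / 2) : ℝ) = ((-φ : ℝ) : ℂ) by push_cast; ring, Complex.exp_mul_I,
        ← Complex.ofReal_cos, ← Complex.ofReal_sin, Real.cos_neg, Real.sin_neg, hcos, hsin]
      push_cast; ring
    rw [e1, e2] at hz
    simp [hg0] at hz
    linear_combination hz

/-- The saddle-point integral up to an exponentially small relative error. -/
theorem norm_integral_saddleIntegrand_sub_le {μ : ℝ} (hμ : 1 ≤ μ) :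
    ‖(∫ u in (-(3 / 4) : ℝ)..(3 / 4), saddleIntegrand μ (1 + u * Complex.I)) -
      ((2 * Real.exp μ * ((1 - 1 / μ) * √(Real.pi / (2 * μ))) : ℝ) : ℂ)‖ ≤
      12 * Real.exp (9 / 10 * μ) := by
  have hμ0 : 0 < μ := by linarith
  obtain ⟨F, hF⟩ := exists_primitive_saddleIntegrand μ
  obtain ⟨s, hs0, hs2, harc⟩ := arc_primitive_sub_eq hμ0 hF
  have hmem (u : ℝ) (hu : u ∈ Set.uIcc (-(3 / 4) : ℝ) (3 / 4)) :
      (1 + u * Complex.I : ℂ) ∈ Metric.ball (1 : ℂ) 1 := by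
    rw [Set.uIcc_of_le (by norm_num)] at hu
    rw [mem_ball_iff_norm, add_sub_cancel_left, norm_mul, Complex.norm_I, mul_one,
      Complex.norm_real, Real.norm_eq_abs, abs_lt]
    constructor <;> linarith [hu.1, hu.2]
  have hline (u : ℝ) : HasDerivAt (fun u : ℝ ↦ (1 + u * Complex.I : ℂ)) Complex.I u := by
    simpa using ((Complex.ofRealCLM.hasDerivAt (x := u)).mul_const Complex.I).const_add 1
  have hftc : ∫ u in (-(3 / 4) : ℝ)..(3 / 4),
      saddleIntegrand μ (1 + u * Complex.I) * Complex.I =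
        F (1 + (3 / 4 : ℝ) * Complex.I) - F (1 + (-(3 / 4) : ℝ) * Complex.I) := by
    refine intervalIntegral.integral_eq_sub_of_hasDerivAt
      (f := fun u : ℝ ↦ F (1 + u * Complex.I))
      (fun u hu ↦ (hF _ (hmem u hu)).comp u (hline u)) ?_
    refine ContinuousOn.intervalIntegrable fun u hu ↦ ContinuousAt.continuousWithinAt ?_
    have hre := re_pos_of_mem_ball_one (hmem u hu)
    have h0 : (1 + u * Complex.I : ℂ) ≠ 0 := by intro h; rw [h] at hre; simp at hre
    have hl := (hline u).continuousAt
    unfold saddleIntegrand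
    exact ((hl.cpow continuousAt_const (Or.inl hre)).mul
      ((hl.add (hl.inv₀ h0)).const_mul _ |>.cexp)).mul_const _
  rw [intervalIntegral.integral_mul_const] at hftc
  have hr1 := norm_radial_primitive_sub_le hμ0.le hF (v := 4 / 5 + 3 / 5 * Complex.I)
    (by simp) (by simp; norm_num)
  have hr2 := norm_radial_primitive_sub_le hμ0.le hF (v := 4 / 5 - 3 / 5 * Complex.I)
    (by simp) (by simp; norm_num)
  have hg := abs_gaussianPrimitive_sub_le hμ hs0 hs2
  rw [← Real.norm_eq_abs, ← Complex.norm_real] at hg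
  rw [show (1 + (3 / 4 : ℝ) * Complex.I : ℂ) = (5 / 4 : ℝ) * (4 / 5 + 3 / 5 * Complex.I) by
    push_cast; ring, show (1 + (-(3 / 4) : ℝ) * Complex.I : ℂ) =
      (5 / 4 : ℝ) * (4 / 5 - 3 / 5 * Complex.I) by push_cast; ring] at hftc
  set J := ∫ u in (-(3 / 4) : ℝ)..(3 / 4), saddleIntegrand μ (1 + u * Complex.I) with hJ
  set A := F ((5 / 4 : ℝ) * (4 / 5 + 3 / 5 * Complex.I)) - F (4 / 5 + 3 / 5 * Complex.I) with hA
  set B := F ((5 / 4 : ℝ) * (4 / 5 - 3 / 5 * Complex.I)) - F (4 / 5 - 3 / 5 * Complex.I) with hB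
  set D := ((gaussianPrimitive μ s - Real.exp μ * ((1 - 1 / μ) * (√(Real.pi / (2 * μ)) / 2)) : ℝ) :
    ℂ) with hD
  have hJ2 : J - ((2 * Real.exp μ * ((1 - 1 / μ) * √(Real.pi / (2 * μ))) : ℝ) : ℂ) =
      -Complex.I * A + Complex.I * B + 4 * D := by
    rw [hD]
    push_cast
    linear_combination (-Complex.I) * hftc - Complex.I * harc + Complex.I * hA - Complex.I * hB +
      (J - 4 * gaussianPrimitive μ s) * Complex.I_sq
  rw [hJ2]
  have h4 : ‖(4 : ℂ) * D‖ = 4 * ‖D‖ := by rw [norm_mul]; norm_num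
  have h5 : ‖-Complex.I * A‖ = ‖A‖ := by simp
  have h6 : ‖Complex.I * B‖ = ‖B‖ := by simp
  refine (norm_add₃_le).trans ?_
  rw [h4, h5, h6]
  linarith

theorem integral_cexp_int_mul_pi (k : ℤ) :
    ∫ x in (-1 : ℝ)..1, Complex.exp (Real.pi * k * Complex.I * x) = if k = 0 then 2 else 0 := by
  split_ifs with hk
  · simp [hk]; norm_num
  · have hc : (Real.pi * k * Complex.I : ℂ) ≠ 0 := by
      simp [hk, Real.pi_ne_zero]
    rw [integral_exp_mul_complex hc, div_eq_zero_iff]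
    left
    rw [sub_eq_zero, Complex.exp_eq_exp_iff_exists_int]
    exact ⟨k, by push_cast; ring⟩

theorem norm_overpartitionFn_mul_cexp_pow (m : ℕ) (y x : ℝ) :
    ‖(overpartitionFn m : ℂ) * Complex.exp (-Real.pi * (y + x * Complex.I)) ^ m‖ =
      overpartitionFn m * Real.exp (-Real.pi * y) ^ m := by
  rw [norm_mul, norm_pow, norm_cexp_neg_pi_mul]
  simp

theorem summable_overpartitionFn_mul_exp_pow {y : ℝ} (hy : 0 < y) :
    Summable fun m ↦ (overpartitionFn m : ℝ) * Real.exp (-Real.pi * y) ^ m :=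
  summable_overpartitionFn_mul_pow (Real.exp_pos _).le
    (Real.exp_lt_one_iff.mpr (by nlinarith [Real.pi_pos]))

theorem continuous_overpartitionGen_vertical {y : ℝ} (hy : 0 < y) :
    Continuous fun x : ℝ ↦ overpartitionGen (Complex.exp (-Real.pi * (y + x * Complex.I))) :=
  continuous_tsum (fun m ↦ by fun_prop) (summable_overpartitionFn_mul_exp_pow hy)
    fun m x ↦ (norm_overpartitionFn_mul_cexp_pow m y x).le

/-- Cauchy's coefficient formula for the overpartition generating function. -/
theorem integral_overpartitionGen_mul_cexp (n : ℕ) {y : ℝ} (hy : 0 < y) :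
    ∫ x in (-1 : ℝ)..1, overpartitionGen (Complex.exp (-Real.pi * (y + x * Complex.I))) *
      Complex.exp (Real.pi * n * (y + x * Complex.I)) = 2 * overpartitionFn n := by
  have hnorm (x : ℝ) : ‖Complex.exp (Real.pi * n * (y + x * Complex.I))‖ =
      Real.exp (Real.pi * n * y) := by
    rw [Complex.norm_exp]
    simp [mul_assoc]
  have hsum := (summable_overpartitionFn_mul_exp_pow hy).mul_right (Real.exp (Real.pi * n * y))
  have h := intervalIntegral.hasSum_integral_of_dominated_convergence (a := -1) (b := 1)
    (μ := MeasureTheory.volume)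
    (F := fun (m : ℕ) (x : ℝ) ↦ (overpartitionFn m : ℂ) *
      Complex.exp (-Real.pi * (y + x * Complex.I)) ^ m *
        Complex.exp (Real.pi * n * (y + x * Complex.I)))
    (f := fun x ↦ overpartitionGen (Complex.exp (-Real.pi * (y + x * Complex.I))) *
      Complex.exp (Real.pi * n * (y + x * Complex.I)))
    (fun m _ ↦ overpartitionFn m * Real.exp (-Real.pi * y) ^ m * Real.exp (Real.pi * n * y))
    (fun m ↦ Continuous.aestronglyMeasurable (by fun_prop))
    (fun m ↦ Eventually.of_forall fun x _ ↦ by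
      rw [norm_mul, norm_overpartitionFn_mul_cexp_pow, hnorm])
    (Eventually.of_forall fun x _ ↦ hsum) intervalIntegrable_const
    (Eventually.of_forall fun x _ ↦ by
      refine HasSum.mul_right _ (Summable.hasSum (Summable.of_norm ?_))
      simpa only [norm_overpartitionFn_mul_cexp_pow] using summable_overpartitionFn_mul_exp_pow hy)
  have hterm (m : ℕ) : (∫ x in (-1 : ℝ)..1, (overpartitionFn m : ℂ) *
      Complex.exp (-Real.pi * (y + x * Complex.I)) ^ m *
        Complex.exp (Real.pi * n * (y + x * Complex.I))) =
      if m = n then 2 * (overpartitionFn n : ℂ) else 0 := by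
    have e (x : ℝ) : (overpartitionFn m : ℂ) *
        Complex.exp (-Real.pi * (y + x * Complex.I)) ^ m *
          Complex.exp (Real.pi * n * (y + x * Complex.I)) =
        overpartitionFn m * Complex.exp (Real.pi * ((n - m : ℤ) : ℂ) * y) *
          Complex.exp (Real.pi * ((n - m : ℤ) : ℂ) * Complex.I * x) := by
      rw [← Complex.exp_nat_mul, mul_assoc, mul_assoc (overpartitionFn m : ℂ),
        ← Complex.exp_add, ← Complex.exp_add]
      congr 2
      push_cast
      ring
    simp_rw [e]
    rw [intervalIntegral.integral_const_mul, integral_cexp_int_mul_pi]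
    rcases eq_or_ne m n with rfl | hmn
    · simp [mul_comm]
    · rw [if_neg, if_neg hmn, mul_zero]
      omega
  simp_rw [hterm] at h
  exact h.unique (hasSum_ite_eq n _)

/-- The contribution of the dominant singularity to the Cauchy integral. -/
noncomputable def majorIntegrand (n : ℕ) (w : ℂ) : ℂ :=
  1 / 2 * w ^ (1 / 2 : ℂ) * Complex.exp (Real.pi / (4 * w)) * Complex.exp (Real.pi * n * w)

theorem ofReal_mul_cpow_half {y : ℝ} (hy : 0 < y) {v : ℂ} (hv : v ≠ 0) :
    ((y : ℂ) * v) ^ (1 / 2 : ℂ) = (√y : ℝ) * v ^ (1 / 2 : ℂ) := by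
  have hy' : (y : ℂ) ≠ 0 := Complex.ofReal_ne_zero.mpr hy.ne'
  rw [Complex.cpow_def_of_ne_zero (mul_ne_zero hy' hv), Complex.cpow_def_of_ne_zero hv,
    Complex.log_ofReal_mul hy hv, add_mul, Complex.exp_add, Real.sqrt_eq_rpow,
    Complex.ofReal_cpow hy.le, Complex.cpow_def_of_ne_zero hy', Complex.ofReal_log hy.le]
  push_cast
  rfl

theorem integral_majorIntegrand {n : ℕ} {y : ℝ} (hy : 0 < y) (hn : (n : ℝ) * (4 * y ^ 2) = 1) :
    ∫ x in (-(3 / 4 * y))..(3 / 4 * y), majorIntegrand n (y + x * Complex.I) =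
      ((1 / 2 * y * √y : ℝ) : ℂ) * ∫ u in (-(3 / 4) : ℝ)..(3 / 4),
        saddleIntegrand (Real.pi / (2 * y)) (1 + u * Complex.I) := by
  have h := intervalIntegral.smul_integral_comp_mul_left (a := -(3 / 4)) (b := 3 / 4)
    (fun x : ℝ ↦ majorIntegrand n (y + x * Complex.I)) y
  rw [show y * -(3 / 4) = -(3 / 4 * y) by ring, mul_comm y] at h
  rw [← h, Complex.real_smul, ← intervalIntegral.integral_const_mul,
    ← intervalIntegral.integral_const_mul]
  refine intervalIntegral.integral_congr fun u _ ↦ ?_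
  have hv : (1 + u * Complex.I : ℂ) ≠ 0 := by
    intro h0
    simpa using congrArg Complex.re h0
  have hy' : (y : ℂ) ≠ 0 := Complex.ofReal_ne_zero.mpr hy.ne'
  have hn' : (n : ℂ) * (4 * y ^ 2) = 1 := by exact_mod_cast congrArg ((↑) : ℝ → ℂ) hn
  have e : (y + (y * u : ℝ) * Complex.I : ℂ) = y * (1 + u * Complex.I) := by push_cast; ring
  have e2 : (Real.pi / (4 * (y * (1 + u * Complex.I))) + Real.pi * n * (y * (1 + u * Complex.I)) :
      ℂ) = (Real.pi / (2 * y) : ℝ) / 2 * ((1 + u * Complex.I) + (1 + u * Complex.I)⁻¹) := by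
    have e3 : (n : ℂ) * y = 1 / (4 * y) := by
      field_simp
      linear_combination hn'
    rw [show (Real.pi * n * (y * (1 + u * Complex.I)) : ℂ) =
      Real.pi * (n * y) * (1 + u * Complex.I) by ring, e3]
    push_cast
    generalize (1 + u * Complex.I : ℂ) = v at hv
    field_simp
    ring
  rw [e, majorIntegrand, saddleIntegrand, ofReal_mul_cpow_half hy hv, mul_assoc _ (Complex.exp _),
    ← Complex.exp_add, e2]
  push_cast
  ring

theorem norm_half_mul_cpow_half_mul_cexp_le {w : ℂ} (hw : 0 < w.re) (h4 : ‖w‖ ≤ 4) :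
    ‖1 / 2 * w ^ (1 / 2 : ℂ) * Complex.exp (Real.pi / (4 * w))‖ ≤
      Real.exp (Real.pi / (4 * w.re)) := by
  have h1 : ‖w ^ (1 / 2 : ℂ)‖ ≤ 2 := by
    refine (pow_le_pow_iff_left₀ (norm_nonneg _) zero_le_two two_ne_zero).mp ?_
    rw [norm_cpow_half_sq]
    linarith
  have h2 : ‖Complex.exp (Real.pi / (4 * w))‖ ≤ Real.exp (Real.pi / (4 * w.re)) := by
    rw [Complex.norm_exp]
    refine Real.exp_le_exp.mpr ?_
    have e : (Real.pi / (4 * w) : ℂ) = ((Real.pi / 4 : ℝ) : ℂ) * w⁻¹ := by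
      push_cast; rw [div_mul_eq_div_div, div_eq_mul_inv _ w]
    have hsq : w.re ^ 2 ≤ Complex.normSq w := by
      rw [Complex.normSq_apply]; nlinarith
    have hinv : w.re / Complex.normSq w ≤ 1 / w.re := by
      rw [div_le_div_iff₀ (by nlinarith) hw]
      linarith
    rw [e, Complex.re_ofReal_mul, Complex.inv_re, div_mul_eq_div_div, div_eq_mul_one_div _ w.re]
    exact mul_le_mul_of_nonneg_left hinv (by positivity)
  rw [norm_mul, norm_mul]
  calc ‖(1 / 2 : ℂ)‖ * ‖w ^ (1 / 2 : ℂ)‖ * ‖Complex.exp (Real.pi / (4 * w))‖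
      ≤ 1 / 2 * 2 * Real.exp (Real.pi / (4 * w.re)) := by
        gcongr
        simp
    _ = _ := by ring

theorem norm_cexp_pi_mul_nat (n : ℕ) (w : ℂ) :
    ‖Complex.exp (Real.pi * n * w)‖ = Real.exp (Real.pi * n * w.re) := by
  rw [Complex.norm_exp]
  simp [mul_assoc]

theorem norm_major_sub_le {n : ℕ} {y x : ℝ} (hy : 0 < y) (hy8 : y ≤ 1 / 8)
    (hn : (n : ℝ) * (4 * y ^ 2) = 1) (hx : |x| ≤ 3 / 4 * y) :
    ‖overpartitionGen (Complex.exp (-Real.pi * (y + x * Complex.I))) *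
      Complex.exp (Real.pi * n * (y + x * Complex.I)) - majorIntegrand n (y + x * Complex.I)‖ ≤
      4 * Real.exp (527 / 528 * (Real.pi / (2 * y))) := by
  have hre : (y + x * Complex.I : ℂ).re = y := by simp
  have him : (y + x * Complex.I : ℂ).im = x := by simp
  have hx2 : x ^ 2 ≤ (3 / 4 * y) ^ 2 := sq_le_sq' (abs_le.mp hx).1 (abs_le.mp hx).2
  generalize (y + x * Complex.I : ℂ) = w at hre him
  have hw : 0 < w.re := hre ▸ hy
  have hns : Complex.normSq w ≤ 25 / 16 * y ^ 2 := by
    rw [Complex.normSq_apply, hre, him]; nlinarith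
  have hns0 : 0 < Complex.normSq w := by
    rw [Complex.normSq_apply, hre, him]; nlinarith
  have hinv : 1 / (2 * y) ≤ (w⁻¹).re := by
    rw [Complex.inv_re, hre, div_le_div_iff₀ (by positivity) hns0]
    nlinarith
  have hinv2 : 1 / 2 ≤ 1 / (2 * y) := one_div_le_one_div_of_le (by positivity) (by linarith)
  have hnorm : ‖w‖ ≤ 4 := by
    refine (pow_le_pow_iff_left₀ (norm_nonneg _) (by norm_num) two_ne_zero).mp ?_
    rw [← Complex.normSq_eq_norm_sq]
    nlinarith
  have h1 := norm_overpartitionGen_sub_le hw (hinv2.trans hinv)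
  have h2 := norm_half_mul_cpow_half_mul_cexp_le hw hnorm
  have h3 : Real.exp (-(2 * Real.pi * (w⁻¹).re)) ≤ Real.exp (-(Real.pi / y)) := by
    refine Real.exp_le_exp.mpr (neg_le_neg ?_)
    calc Real.pi / y = 2 * Real.pi * (1 / (2 * y)) := by field_simp
      _ ≤ _ := by gcongr
  have hny : (n : ℝ) * y = 1 / (4 * y) := by
    field_simp
    linear_combination hn
  rw [majorIntegrand, ← sub_mul, norm_mul, norm_cexp_pi_mul_nat]
  rw [hre] at h2 ⊢
  have hd : 0 < Real.pi / y := by positivity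
  calc _ ≤ Real.exp (Real.pi / (4 * y)) * (4 * Real.exp (-(Real.pi / y))) *
        Real.exp (Real.pi * n * y) := by
        refine mul_le_mul_of_nonneg_right (h1.trans ?_) (Real.exp_pos _).le
        gcongr
    _ = 4 * Real.exp (-(1 / 2) * (Real.pi / y)) := by
        rw [mul_assoc Real.pi, hny, mul_left_comm, mul_assoc, mul_assoc, ← Real.exp_add,
          ← Real.exp_add]
        congr 2
        field_simp
        ring
    _ ≤ _ := by
        rw [show Real.pi / (2 * y) = 1 / 2 * (Real.pi / y) by field_simp]
        refine mul_le_mul_of_nonneg_left (Real.exp_le_exp.mpr ?_) zero_le_four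
        linarith

theorem norm_minor_le {n : ℕ} {y x : ℝ} (hy : 0 < y) (hy8 : y ≤ 1 / 8)
    (hn : (n : ℝ) * (4 * y ^ 2) = 1) (hx : 3 / 4 * y ≤ |x|) (hx1 : |x| ≤ 1) :
    ‖overpartitionGen (Complex.exp (-Real.pi * (y + x * Complex.I))) *
      Complex.exp (Real.pi * n * (y + x * Complex.I))‖ ≤
      5 * Real.exp (527 / 528 * (Real.pi / (2 * y))) := by
  have hre : (y + x * Complex.I : ℂ).re = y := by simp
  have him : (y + x * Complex.I : ℂ).im = x := by simp
  have hyi : 8 ≤ 1 / y := by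
    rw [le_div_iff₀ hy]; linarith
  have hinv : (((y : ℂ))⁻¹).re = 1 / y := by
    rw [← Complex.ofReal_inv, Complex.ofReal_re, one_div]
  have h1 := norm_overpartitionGen_le_of_minor (w := y + x * Complex.I) (by rwa [hre])
    (by rwa [hre]) (by rwa [hre, him]) (by rwa [him])
  have h2 := norm_overpartitionGen_sub_le (w := y) (by simpa) (by rw [hinv]; linarith)
  have h3 := norm_half_mul_cpow_half_mul_cexp_le (w := y) (by simpa)
    (by rw [Complex.norm_real, Real.norm_of_nonneg hy.le]; linarith)
  rw [hinv] at h2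
  rw [Complex.ofReal_re] at h3
  rw [hre] at h1
  have h4 : Real.exp (-(2 * Real.pi * (1 / y))) ≤ 1 :=
    Real.exp_le_one_iff.mpr (neg_nonpos.mpr (by positivity))
  have h5 : ‖overpartitionGen (Complex.exp (-Real.pi * (y : ℂ)))‖ ≤
      5 * Real.exp (Real.pi / (4 * y)) := by
    have := norm_le_norm_add_norm_sub'
      (overpartitionGen (Complex.exp (-Real.pi * (y : ℂ))))
      (1 / 2 * (y : ℂ) ^ (1 / 2 : ℂ) * Complex.exp (Real.pi / (4 * y)))
    nlinarith [norm_nonneg (1 / 2 * (y : ℂ) ^ (1 / 2 : ℂ) * Complex.exp (Real.pi / (4 * y)))]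
  have hny : (n : ℝ) * y = 1 / (4 * y) := by
    field_simp
    linear_combination hn
  rw [norm_mul, norm_cexp_pi_mul_nat, hre]
  calc _ ≤ 5 * Real.exp (Real.pi / (4 * y)) * Real.exp (-(1 / (264 * y))) *
        Real.exp (Real.pi * n * y) := by
        refine mul_le_mul_of_nonneg_right (h1.trans ?_) (Real.exp_pos _).le
        gcongr
    _ = 5 * Real.exp (Real.pi / (4 * y) + -(1 / (264 * y)) + Real.pi * (1 / (4 * y))) := by
        rw [mul_assoc Real.pi, hny, Real.exp_add, Real.exp_add]
        ring
    _ ≤ _ := by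
        gcongr
        have e : Real.pi / (4 * y) + -(1 / (264 * y)) + Real.pi * (1 / (4 * y)) =
            (Real.pi / 2 - 1 / 264) * (1 / y) := by
          field_simp
          ring
        have e' : 527 / 528 * (Real.pi / (2 * y)) = 527 / 528 * (Real.pi / 2) * (1 / y) := by
          field_simp
        rw [e, e']
        refine mul_le_mul_of_nonneg_right ?_ (by positivity)
        linarith [Real.pi_le_four]

/-- The overpartition function up to an exponentially small relative error. -/
theorem abs_overpartitionFn_sub_le {n : ℕ} (hn : 16 ≤ n) :
    |(overpartitionFn n : ℝ) -
      Real.pi ^ 2 * Real.exp (muPbar n) / (8 * muPbar n ^ 2) * (1 - 1 / muPbar n)| ≤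
      16 * Real.exp (527 / 528 * muPbar n) := by
  have hn0 : (16 : ℝ) ≤ n := by exact_mod_cast hn
  have hsq4 : 4 ≤ √(n : ℝ) := Real.le_sqrt_of_sq_le (by linarith)
  obtain ⟨y, hydef⟩ : ∃ y, y = 1 / (2 * √(n : ℝ)) := ⟨_, rfl⟩
  have hy : 0 < y := by rw [hydef]; positivity
  have hy8 : y ≤ 1 / 8 := by
    rw [hydef]
    exact one_div_le_one_div_of_le (by norm_num) (by linarith)
  have hny : (n : ℝ) * (4 * y ^ 2) = 1 := by
    have : √(n : ℝ) ^ 2 = n := Real.sq_sqrt (by linarith)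
    rw [hydef, div_pow, mul_pow, this]
    field_simp
    norm_num
  have hμy : muPbar n = Real.pi / (2 * y) := by
    rw [muPbar, hydef]
    field_simp
  have hπ := Real.pi_gt_three
  have hμ1 : 1 ≤ muPbar n := by rw [muPbar]; nlinarith
  have hyμ : Real.pi / (2 * muPbar n) = y := by
    rw [hμy]; field_simp
  set E := Real.exp (527 / 528 * (Real.pi / (2 * y))) with hE
  have hE0 : 0 < E := Real.exp_pos _
  have hsy : √y ≤ 1 := Real.sqrt_le_one.mpr (by linarith)
  set g : ℝ → ℂ := fun x ↦ overpartitionGen (Complex.exp (-Real.pi * (y + x * Complex.I))) *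
      Complex.exp (Real.pi * n * (y + x * Complex.I)) with hg
  have hgc : Continuous g := (continuous_overpartitionGen_vertical hy).mul (by fun_prop)
  have hMc : Continuous fun x : ℝ ↦ majorIntegrand n (y + x * Complex.I) := by
    have hl : Continuous fun x : ℝ ↦ (y + x * Complex.I : ℂ) := by fun_prop
    have h0 (x : ℝ) : (y + x * Complex.I : ℂ) ∈ Complex.slitPlane := Or.inl (by simpa)
    unfold majorIntegrand
    exact ((continuous_const.mul (hl.cpow continuous_const h0)).mul
      (continuous_const.div (continuous_const.mul hl) fun x ↦
        mul_ne_zero (by norm_num) (Complex.slitPlane_ne_zero (h0 x))).cexp).mul (by fun_prop)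
  have hcauchy : ∫ x in (-1 : ℝ)..1, g x = 2 * overpartitionFn n :=
    integral_overpartitionGen_mul_cexp n hy
  rw [← intervalIntegral.integral_add_adjacent_intervals (b := -(3 / 4 * y))
    (hgc.intervalIntegrable _ _) (hgc.intervalIntegrable _ _),
    ← intervalIntegral.integral_add_adjacent_intervals (a := -(3 / 4 * y)) (b := 3 / 4 * y)
    (hgc.intervalIntegrable _ _) (hgc.intervalIntegrable _ _)] at hcauchy
  have hleft : ‖∫ x in (-1 : ℝ)..(-(3 / 4 * y)), g x‖ ≤ 5 * E := by
    refine (intervalIntegral.norm_integral_le_of_norm_le_const (C := 5 * E) fun x hx ↦ ?_).trans ?_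
    · rw [Set.uIoc_of_le (by linarith)] at hx
      have hx0 : x ≤ 0 := by linarith [hx.2]
      exact norm_minor_le hy hy8 hny (by rw [abs_of_nonpos hx0]; linarith [hx.2])
        (by rw [abs_of_nonpos hx0]; linarith [hx.1])
    · rw [abs_of_nonneg (by linarith)]
      nlinarith
  have hright : ‖∫ x in (3 / 4 * y)..1, g x‖ ≤ 5 * E := by
    refine (intervalIntegral.norm_integral_le_of_norm_le_const (C := 5 * E) fun x hx ↦ ?_).trans ?_
    · rw [Set.uIoc_of_le (by linarith)] at hx
      have hx0 : 0 ≤ x := by linarith [hx.1]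
      exact norm_minor_le hy hy8 hny (by rw [abs_of_nonneg hx0]; linarith [hx.1])
        (by rw [abs_of_nonneg hx0]; linarith [hx.2])
    · rw [abs_of_nonneg (by linarith)]
      nlinarith
  have hmid : ‖(∫ x in (-(3 / 4 * y))..(3 / 4 * y), g x) -
      ∫ x in (-(3 / 4 * y))..(3 / 4 * y), majorIntegrand n (y + x * Complex.I)‖ ≤ 4 * E := by
    rw [← intervalIntegral.integral_sub (hgc.intervalIntegrable _ _)
      (hMc.intervalIntegrable _ _)]
    refine (intervalIntegral.norm_integral_le_of_norm_le_const (C := 4 * E) fun x hx ↦ ?_).trans ?_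
    · rw [Set.uIoc_of_le (by linarith)] at hx
      exact norm_major_sub_le hy hy8 hny (abs_le.mpr ⟨hx.1.le, hx.2⟩)
    · rw [abs_of_nonneg (by linarith)]
      nlinarith
  have hsaddle := norm_integral_saddleIntegrand_sub_le hμ1
  rw [hyμ, hμy] at hsaddle
  rw [integral_majorIntegrand hy hny] at hmid
  set J := ∫ u in (-(3 / 4) : ℝ)..(3 / 4),
    saddleIntegrand (Real.pi / (2 * y)) (1 + u * Complex.I) with hJ
  set P := Real.pi ^ 2 * Real.exp (muPbar n) / (8 * muPbar n ^ 2) * (1 - 1 / muPbar n) with hP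
  have hPe : 1 / 2 * y * √y * (2 * Real.exp (Real.pi / (2 * y)) *
      ((1 - 1 / (Real.pi / (2 * y))) * √y)) = 2 * P := by
    have hyy : √y * √y = y := Real.mul_self_sqrt hy.le
    rw [hP, hμy]
    field_simp
    linear_combination (8 * (Real.pi - 2 * y)) * hyy
  have hmain : ‖((1 / 2 * y * √y : ℝ) : ℂ) * J - ((2 * P : ℝ) : ℂ)‖ ≤ 12 * E := by
    rw [← hPe, Complex.ofReal_mul (1 / 2 * y * √y), ← mul_sub, norm_mul, Complex.norm_real,
      Real.norm_of_nonneg (by positivity)]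
    have h1 : 1 / 2 * y * √y ≤ 1 := by nlinarith [Real.sqrt_nonneg y]
    have h2 : Real.exp (9 / 10 * (Real.pi / (2 * y))) ≤ E := by
      refine Real.exp_le_exp.mpr (mul_le_mul_of_nonneg_right (by norm_num) (by positivity))
    calc _ ≤ 1 * (12 * Real.exp (9 / 10 * (Real.pi / (2 * y)))) := by gcongr
      _ ≤ _ := by linarith
  have htotal : ‖((2 * (overpartitionFn n - P) : ℝ) : ℂ)‖ ≤ 5 * E + (4 * E + 12 * E) + 5 * E := by
    have e : ((2 * (overpartitionFn n - P) : ℝ) : ℂ) =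
        (∫ x in (-1 : ℝ)..(-(3 / 4 * y)), g x) +
        (((∫ x in (-(3 / 4 * y))..(3 / 4 * y), g x) - ((1 / 2 * y * √y : ℝ) : ℂ) * J) +
          (((1 / 2 * y * √y : ℝ) : ℂ) * J - ((2 * P : ℝ) : ℂ))) +
        ∫ x in (3 / 4 * y)..1, g x := by
      push_cast
      linear_combination -hcauchy
    rw [e]
    refine norm_add₃_le.trans ?_
    gcongr
    refine (norm_add_le _ _).trans ?_
    gcongr
  rw [Complex.norm_real, Real.norm_eq_abs, abs_mul, abs_two] at htotal
  rw [hμy, ← hE]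
  linarith

theorem eventually_exp_lt_exp_div_pow (t : ℕ) :
    ∀ᶠ μ : ℝ in atTop, 16 * Real.exp (527 / 528 * μ) <
      Real.pi ^ 2 * Real.exp μ / (8 * μ ^ 2) * (1 / μ ^ t) := by
  have h := Real.tendsto_pow_mul_exp_neg_atTop_nhds_zero (t + 2)
  have h2 : Tendsto (fun μ : ℝ ↦ μ / 528) atTop atTop := tendsto_id.atTop_div_const (by norm_num)
  have h3 := (h.comp h2).const_mul (16 * 528 ^ (t + 2))
  rw [mul_zero] at h3
  filter_upwards [h3.eventually (gt_mem_nhds one_pos), eventually_gt_atTop 0] with μ hμ hμ0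
  have hπ : 8 ≤ Real.pi ^ 2 := by nlinarith [Real.pi_gt_three]
  have e : Real.exp μ = Real.exp (527 / 528 * μ) * Real.exp (μ / 528) := by
    rw [← Real.exp_add]; ring_nf
  have hlt : 16 * μ ^ (t + 2) < Real.exp (μ / 528) := by
    simp only [Function.comp_apply, div_pow, Real.exp_neg] at hμ
    field_simp at hμ
    exact hμ
  rw [div_mul_div_comm, lt_div_iff₀ (by positivity), e]
  calc 16 * Real.exp (527 / 528 * μ) * (8 * μ ^ 2 * μ ^ t)
      = 8 * (Real.exp (527 / 528 * μ) * (16 * μ ^ (t + 2))) := by ring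
    _ < 8 * (Real.exp (527 / 528 * μ) * Real.exp (μ / 528)) := by gcongr
    _ ≤ Real.pi ^ 2 * (Real.exp (527 / 528 * μ) * Real.exp (μ / 528)) * 1 := by
        rw [mul_one]; gcongr

theorem tendsto_muPbar : Tendsto muPbar atTop atTop :=
  (Real.tendsto_sqrt_atTop.comp tendsto_natCast_atTop_atTop).const_mul_atTop Real.pi_pos

end

theorem overpartition_bounds (t : ℕ) (ht : 0 < t) :
    ∃ N : ℕ, 0 < N ∧ ∀ n : ℕ, N ≤ n →
      Real.pi ^ 2 * Real.exp (muPbar n) / (8 * (muPbar n) ^ 2) *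
          (1 - 1 / muPbar n - 1 / (muPbar n) ^ t) < (overpartitionFn n : ℝ) ∧
      (overpartitionFn n : ℝ) <
        Real.pi ^ 2 * Real.exp (muPbar n) / (8 * (muPbar n) ^ 2) *
          (1 - 1 / muPbar n + 1 / (muPbar n) ^ t) := by
  obtain ⟨N, hN⟩ := Filter.eventually_atTop.mp
    (tendsto_muPbar.eventually (eventually_exp_lt_exp_div_pow t))
  refine ⟨max N 16, by positivity, fun n hn ↦ ?_⟩
  have h1 := abs_le.mp (abs_overpartitionFn_sub_le ((le_max_right N 16).trans hn))
  have h2 := hN n ((le_max_left N 16).trans hn)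
  rw [mul_sub, mul_add]
  exact ⟨by linarith [h1.1], by linarith [h1.2]⟩
end
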